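/- arXiv:2405.06755 — 2 statements merged into one kernel-verified Lean document; each statement's English description precedes it below -/
import Mathlib

section
/- Every graph that admits a tree-decomposition into finite parts admits a rooted tree-decomposition into finite parts that is simultaneously linked, tight and componental. -/
open SimpleGraph

universe u v

section CommonDefs

variable {V : Type u} {N : Type v}

/-- `u` and `w` are joined by a walk in `G` all of whose vertices avoid `X`,
i.e. they lie in the same component of `G - X`. -/
def ConnAvoiding (G : SimpleGraph V) (X : Set V) (u w : V) : Prop :=
  ∃ p : G.Walk u w, ∀ x ∈ p.support, x ∉ X

/-- `r` is a (one-way infinite) ray in `G`. -/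
def IsRay (G : SimpleGraph V) (r : ℕ → V) : Prop :=
  Function.Injective r ∧ ∀ n : ℕ, G.Adj (r n) (r (n + 1))

/-- Two rays are equivalent (i.e. belong to the same end) if for every finite vertex set `X`
they have tails in the same component of `G - X`. -/
def RayEquiv (G : SimpleGraph V) (r r' : ℕ → V) : Prop :=
  ∀ X : Set V, X.Finite → ∃ M : ℕ, ∀ m ≥ M, ∀ n ≥ M, ConnAvoiding G X (r m) (r' n)

/-- `v` lies in the component `C_G(X, ε)` of `G - X` containing a tail of the ray `r`. -/
def InEndComp (G : SimpleGraph V) (X : Set V) (r : ℕ → V) (v : V) : Prop :=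
  ∃ M : ℕ, ∀ n ≥ M, ConnAvoiding G X v (r n)

/-- `v` dominates the end of the ray `r`. -/
def Dominates (G : SimpleGraph V) (r : ℕ → V) (v : V) : Prop :=
  ∀ X : Set V, X.Finite → v ∉ X → InEndComp G X r v

/-- `Dom(ε)` for the end `ε` of the ray `r`. -/
def DomSet (G : SimpleGraph V) (r : ℕ → V) : Set V := {v | Dominates G r v}

/-- There are `n` pairwise (vertex-)disjoint rays belonging to the end of `r`. -/
def HasDisjRays (G : SimpleGraph V) (r : ℕ → V) (n : ℕ) : Prop :=
  ∃ f : Fin n → ℕ → V, (∀ i, IsRay G (f i)) ∧ (∀ i, RayEquiv G r (f i)) ∧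
    Pairwise fun i j => ∀ k l : ℕ, f i k ≠ f j l

/-- The degree of the end of `r`, as an extended natural number. -/
noncomputable def EndDegree (G : SimpleGraph V) (r : ℕ → V) : ℕ∞ :=
  ⨆ (n : ℕ) (_ : HasDisjRays G r n), (n : ℕ∞)

/-- A family of pairwise disjoint `A`–`B` paths indexed by `ι`. -/
def DisjointPathsFam (G : SimpleGraph V) (A B : Set V) (ι : Type*) : Prop :=
  ∃ (a b : ι → V) (p : ∀ i : ι, G.Walk (a i) (b i)),
    (∀ i, (p i).IsPath) ∧ (∀ i, a i ∈ A) ∧ (∀ i, b i ∈ B) ∧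
    Pairwise fun i j => ∀ x ∈ (p i).support, x ∉ (p j).support

/-- There are `n` pairwise disjoint `A`–`B` paths in `G`. -/
def DisjointPaths (G : SimpleGraph V) (A B : Set V) (n : ℕ) : Prop :=
  DisjointPathsFam G A B (Fin n)

/-- `C` is (the vertex set of) a connected component of the subgraph of `G` induced on `S`. -/
def IsCompOf (G : SimpleGraph V) (S C : Set V) : Prop :=
  C.Nonempty ∧ C ⊆ S ∧ (G.induce C).Connected ∧
    ∀ u ∈ C, ∀ v ∈ S, G.Adj u v → v ∈ C

/-- The neighbourhood `N_G(C)` of the set `C` in `G`. -/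
def NbhdSet (G : SimpleGraph V) (C : Set V) : Set V :=
  {v | v ∉ C ∧ ∃ u ∈ C, G.Adj u v}

/-- A graph is locally finite if every vertex has finite degree. -/
def LocFin (G : SimpleGraph V) : Prop := ∀ v : V, {w : V | G.Adj v w}.Finite

/-- A tree-decomposition of `G` with decomposition tree `T`. -/
structure TreeDecomp (G : SimpleGraph V) (T : SimpleGraph N) : Type (max u v) where
  isTree : T.IsTree
  bag : N → Set V
  bag_cover : ∀ v : V, ∃ t : N, v ∈ bag t
  bag_edge : ∀ ⦃x y : V⦄, G.Adj x y → ∃ t : N, x ∈ bag t ∧ y ∈ bag t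
  bag_conn : ∀ (v : V) {s t : N} (p : T.Walk s t), p.IsPath →
    v ∈ bag s → v ∈ bag t → ∀ x ∈ p.support, v ∈ bag x

namespace TreeDecomp

variable {G : SimpleGraph V} {T : SimpleGraph N}

/-- The unique path in the tree `T` from `s` to `t`. -/
noncomputable def path (D : TreeDecomp G T) (s t : N) : T.Walk s t :=
  (D.isTree.existsUnique_path s t).choose

/-- The adhesion set of the edge `ab` of `T`. -/
def adh (D : TreeDecomp G T) (a b : N) : Set V := D.bag a ∩ D.bag b

/-- `ab` is an edge of `T` lying on the path from `s` to `t`. -/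
def EdgeOnPath (D : TreeDecomp G T) (s t a b : N) : Prop :=
  T.Adj a b ∧ s(a, b) ∈ (D.path s t).edges

/-- All bags are finite. -/
def FiniteParts (D : TreeDecomp G T) : Prop := ∀ t : N, (D.bag t).Finite

/-- The tree-decomposition is lean. -/
def IsLean (D : TreeDecomp G T) : Prop :=
  ∀ (s t : N) (Zs Zt : Finset V), ↑Zs ⊆ D.bag s → ↑Zt ⊆ D.bag t →
    Zs.card = Zt.card →
    DisjointPaths G ↑Zs ↑Zt Zs.card ∨
      ∃ a b : N, D.EdgeOnPath s t a b ∧ (D.adh a b).encard < (Zs.card : ℕ∞)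

/-- The tree-decomposition is strongly linked: for all nodes `s ≠ t` there are
`min {|V_e| : e ∈ E(sTt)}` pairwise disjoint `V_s`–`V_t` paths. -/
def StronglyLinked (D : TreeDecomp G T) : Prop :=
  ∀ s t : N, s ≠ t →
    ∃ c : Cardinal.{u},
      (∀ a b : N, D.EdgeOnPath s t a b → c ≤ Cardinal.mk ↥(D.adh a b)) ∧
      (∃ a b : N, D.EdgeOnPath s t a b ∧ c = Cardinal.mk ↥(D.adh a b)) ∧
      ∃ ι : Type u, Cardinal.mk ι = c ∧ DisjointPathsFam G (D.bag s) (D.bag t) ι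

/-- One side of the separation of `G` induced by the edge `ab` of `T`: the union of the
bags over all nodes in the component of `T - ab` containing `a`. -/
def sideSet (D : TreeDecomp G T) (a b : N) : Set V :=
  ⋃ x ∈ {x : N | b ∉ (D.path a x).support}, D.bag x

end TreeDecomp

/-- A rooted tree-decomposition. -/
structure RootedTreeDecomp (G : SimpleGraph V) (T : SimpleGraph N)
    extends TreeDecomp G T : Type (max u v) where
  root : N

namespace RootedTreeDecomp

variable {G : SimpleGraph V} {T : SimpleGraph N}

/-- The tree-order on `T` induced by the root: `s ≤ t` iff `s` lies on the path
from the root to `t`. -/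
def le (D : RootedTreeDecomp G T) (s t : N) : Prop :=
  s ∈ (D.toTreeDecomp.path D.root t).support

/-- `st` is an edge of `T` with `s < t` in the tree-order. -/
def IsOrientedEdge (D : RootedTreeDecomp G T) (s t : N) : Prop :=
  T.Adj s t ∧ D.le s t

/-- The vertex set of `G↑e` for the oriented edge `e = st`: the union of the bags over
all nodes of the component `T_e` of `T - e` not containing the root. -/
def above (D : RootedTreeDecomp G T) (t : N) : Set V :=
  ⋃ x ∈ {x : N | D.le t x}, D.bag x

/-- The vertex set of `G∘↑e` (the part strictly above `e`) for the oriented edge `e = st`. -/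
def strictAbove (D : RootedTreeDecomp G T) (s t : N) : Set V :=
  D.above t \ (D.bag s ∩ D.bag t)

/-- The rooted tree-decomposition is componental. -/
def Componental (D : RootedTreeDecomp G T) : Prop :=
  ∀ s t : N, D.IsOrientedEdge s t → (G.induce (D.strictAbove s t)).Connected

/-- The rooted tree-decomposition is tight. -/
def Tight (D : RootedTreeDecomp G T) : Prop :=
  ∀ s t : N, D.IsOrientedEdge s t →
    ∃ C : Set V, IsCompOf G (D.strictAbove s t) C ∧ NbhdSet G C = D.bag s ∩ D.bag t

/-- The rooted tree-decomposition is linked: for all comparable nodes `s < t` there are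
`min {|V_e| : e ∈ E(sTt)}` pairwise disjoint `V_s`–`V_t` paths. -/
def Linked (D : RootedTreeDecomp G T) : Prop :=
  ∀ s t : N, D.le s t → s ≠ t →
    ∃ c : Cardinal.{u},
      (∀ a b : N, D.toTreeDecomp.EdgeOnPath s t a b →
        c ≤ Cardinal.mk ↥(D.bag a ∩ D.bag b)) ∧
      (∃ a b : N, D.toTreeDecomp.EdgeOnPath s t a b ∧
        c = Cardinal.mk ↥(D.bag a ∩ D.bag b)) ∧
      ∃ ι : Type u, Cardinal.mk ι = c ∧ DisjointPathsFam G (D.bag s) (D.bag t) ι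

/-- A rooted ray of `T`, i.e. a ray starting at the root. -/
def IsRootedRay (D : RootedTreeDecomp G T) (ρ : ℕ → N) : Prop :=
  IsRay T ρ ∧ ρ 0 = D.root

/-- `liminf_{e ∈ E(R)} V_e`: the vertices lying in `V_e` for all but finitely many
edges `e` of the ray `R = ρ`. -/
def bagLiminf (D : RootedTreeDecomp G T) (ρ : ℕ → N) : Set V :=
  {v | ∃ M : ℕ, ∀ n ≥ M, v ∈ D.bag (ρ n) ∩ D.bag (ρ (n + 1))}

/-- `liminf_{e ∈ E(R)} |V_e|` for the ray `R = ρ`. -/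
noncomputable def adhLiminf (D : RootedTreeDecomp G T) (ρ : ℕ → N) : ℕ∞ :=
  Filter.liminf (fun n : ℕ => (D.bag (ρ n) ∩ D.bag (ρ (n + 1))).encard) Filter.atTop

/-- The end of the ray `r` of `G` gives rise to the rooted ray `ρ` of `T`: every ray
equivalent to `r` meets every bag along `ρ` only finitely often, and for every edge
`e = st` of `ρ` the component `C_G(V_s, ε)` is contained in `G∘↑e`. -/
def GivesRise (D : RootedTreeDecomp G T) (r : ℕ → V) (ρ : ℕ → N) : Prop :=
  D.IsRootedRay ρ ∧
  (∀ r' : ℕ → V, IsRay G r' → RayEquiv G r r' →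
    ∀ n : ℕ, {k : ℕ | r' k ∈ D.bag (ρ n)}.Finite) ∧
  (∀ (n : ℕ) (v : V), InEndComp G (D.bag (ρ n)) r v →
    v ∈ D.strictAbove (ρ n) (ρ (n + 1)))

end RootedTreeDecomp

/-- `{A, B}` is a separation of `G`. -/
def IsSeparation (G : SimpleGraph V) (A B : Set V) : Prop :=
  A ∪ B = Set.univ ∧ ∀ a ∈ A \ B, ∀ b ∈ B \ A, ¬ G.Adj a b

/-- The separation `{A, B}` separates the ends of `r` and `r'`: they live in components of
`G - (A ∩ B)` contained in different sides of `{A, B}`. -/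
def SepSeparatesEnds (G : SimpleGraph V) (A B : Set V) (r r' : ℕ → V) : Prop :=
  ((∀ v, InEndComp G (A ∩ B) r v → v ∈ A \ B) ∧
    (∀ v, InEndComp G (A ∩ B) r' v → v ∈ B \ A)) ∨
  ((∀ v, InEndComp G (A ∩ B) r v → v ∈ B \ A) ∧
    (∀ v, InEndComp G (A ∩ B) r' v → v ∈ A \ B))

/-- The separation `{A, B}` efficiently distinguishes the ends of `r` and `r'`. -/
def EffDistinguishes (G : SimpleGraph V) (A B : Set V) (r r' : ℕ → V) : Prop :=
  IsSeparation G A B ∧ SepSeparatesEnds G A B r r' ∧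
    ∀ A' B' : Set V, IsSeparation G A' B' → SepSeparatesEnds G A' B' r r' →
      (A ∩ B).encard ≤ (A' ∩ B').encard

/-- The tree-decomposition `D` distinguishes the ends of `r` and `r'` efficiently. -/
def TreeDecomp.EffDistinguishesEnds {G : SimpleGraph V} {T : SimpleGraph N}
    (D : TreeDecomp G T) (r r' : ℕ → V) : Prop :=
  ∃ a b : N, T.Adj a b ∧ EffDistinguishes G (D.sideSet a b) (D.sideSet b a) r r'

/-- `G` contains `H` as a minor. -/
def HasMinor {W : Type v} (G : SimpleGraph V) (H : SimpleGraph W) : Prop :=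
  ∃ B : W → Set V, (∀ h, (B h).Nonempty) ∧ (∀ h, (G.induce (B h)).Connected) ∧
    (Pairwise fun h h' => Disjoint (B h) (B h')) ∧
    ∀ ⦃h h'⦄, H.Adj h h' → ∃ u ∈ B h, ∃ w ∈ B h', G.Adj u w

/-- The half-grid: the graph on `ℕ × ℤ` in which `(i, j)` and `(i', j')` are adjacent
iff `|i - i'| + |j - j'| = 1`. -/
def halfGrid : SimpleGraph (ℕ × ℤ) :=
  SimpleGraph.fromRel fun p q =>
    ((p.1 : ℤ) - (q.1 : ℤ)).natAbs + (p.2 - q.2).natAbs = 1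

/-- The one-way infinite path on `ℕ`. -/
def natRayGraph : SimpleGraph ℕ :=
  SimpleGraph.fromRel fun m n => n = m + 1

/-- The path on `m` vertices. -/
def finPathGraph (m : ℕ) : SimpleGraph (Fin m) :=
  SimpleGraph.fromRel fun i j => (j : ℕ) = (i : ℕ) + 1

/-- The strong product of two graphs. -/
def strongProd {W : Type v} (G : SimpleGraph V) (H : SimpleGraph W) : SimpleGraph (V × W) :=
  SimpleGraph.fromRel fun x y =>
    (x.1 = y.1 ∨ G.Adj x.1 y.1) ∧ (x.2 = y.2 ∨ H.Adj x.2 y.2)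

end CommonDefs

namespace LinkedDecomp

variable {V : Type u} {G : SimpleGraph V}

/-- The number of neighbours of a vertex set. -/
noncomputable def ord (G : SimpleGraph V) (X : Set V) : ℕ∞ := (NbhdSet G X).encard

theorem mem_nbhd {X : Set V} {v : V} : v ∈ NbhdSet G X ↔ v ∉ X ∧ ∃ u ∈ X, G.Adj u v := Iff.rfl

theorem encard_add_le {α : Type*} {A B C D : Set α} (h₁ : A ∪ B ⊆ C ∪ D) (h₂ : A ∩ B ⊆ C ∩ D) :
    A.encard + B.encard ≤ C.encard + D.encard := by
  rw [← Set.encard_union_add_encard_inter, ← Set.encard_union_add_encard_inter C]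
  exact add_le_add (Set.encard_le_encard h₁) (Set.encard_le_encard h₂)

theorem ord_mono {X Y : Set V} (h : NbhdSet G X ⊆ NbhdSet G Y) : ord G X ≤ ord G Y :=
  Set.encard_le_encard h

theorem ord_submodular (X Y : Set V) :
    ord G (X ∪ Y) + ord G (X ∩ Y) ≤ ord G X + ord G Y := by
  apply encard_add_le
  · rintro v (⟨h, u, hu, huv⟩ | ⟨h, u, hu, huv⟩) <;>
    simp only [Set.mem_union, Set.mem_inter_iff, mem_nbhd] at * <;> grind
  · rintro v ⟨⟨h, u, hu, huv⟩, ⟨h', u', hu', huv'⟩⟩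
    simp only [Set.mem_union, Set.mem_inter_iff, mem_nbhd] at *
    grind

theorem ord_posimodular (X Y : Set V) :
    ord G (X \ (Y ∪ NbhdSet G Y)) + ord G (Y \ (X ∪ NbhdSet G X)) ≤ ord G X + ord G Y := by
  apply encard_add_le
  · rintro v (⟨h, u, hu, huv⟩ | ⟨h, u, hu, huv⟩) <;>
    simp only [Set.mem_union, Set.mem_sdiff, mem_nbhd] at * <;> grind [SimpleGraph.adj_comm]
  · rintro v ⟨⟨h, u, hu, huv⟩, ⟨h', u', hu', huv'⟩⟩
    simp only [Set.mem_union, Set.mem_inter_iff, Set.mem_sdiff, mem_nbhd] at *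
    grind [SimpleGraph.adj_comm]

/-- `E` is closed in `Z` under adjacency. -/
def ClosedIn (G : SimpleGraph V) (Z E : Set V) : Prop := ∀ u ∈ E, ∀ v ∈ Z, G.Adj u v → v ∈ E

theorem nbhd_inter_subset {Z E D : Set V} (hE : ClosedIn G Z E) (hD : D ⊆ Z) :
    NbhdSet G (D ∩ E) ⊆ NbhdSet G D := by
  rintro v ⟨h, u, hu, huv⟩
  refine ⟨fun hv => h ⟨hv, hE u hu.2 v (hD hv) huv⟩, u, hu.1, huv⟩

theorem ord_inter_le {Z E D : Set V} (hE : ClosedIn G Z E) (hD : D ⊆ Z) :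
    ord G (D ∩ E) ≤ ord G D := ord_mono (nbhd_inter_subset hE hD)

theorem _root_.IsCompOf.closedIn {S C : Set V} (h : IsCompOf G S C) : ClosedIn G S C := h.2.2.2

theorem subset_of_connected_of_closed {X E : Set V} (hX : (G.induce X).Connected)
    (hne : (X ∩ E).Nonempty) (hcl : ∀ u ∈ X, u ∈ E → ∀ v ∈ X, G.Adj u v → v ∈ E) : X ⊆ E := by
  obtain ⟨x, hx, hxE⟩ := hne
  intro y hy
  obtain ⟨p⟩ := hX.preconnected ⟨x, hx⟩ ⟨y, hy⟩
  have : ∀ (a b : X), (G.induce X).Walk a b → a.1 ∈ E → b.1 ∈ E := by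
    intro a b p
    induction p with
    | nil => exact id
    | cons h _ ih => exact fun ha => ih (hcl _ (Subtype.prop _) ha _ (Subtype.prop _) h)
  exact this _ _ p hxE

theorem _root_.IsCompOf.subset_of_meets {S C X : Set V} (h : IsCompOf G S C)
    (hX : (G.induce X).Connected) (hXS : X ⊆ S) (hne : (X ∩ C).Nonempty) : X ⊆ C :=
  subset_of_connected_of_closed hX hne fun u _ hu v hv huv => h.closedIn u hu v (hXS hv) huv

theorem _root_.IsCompOf.eq_of_meets {S C C' : Set V} (h : IsCompOf G S C) (h' : IsCompOf G S C')
    (hne : (C ∩ C').Nonempty) : C = C' :=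
  (h'.subset_of_meets h.2.2.1 h.2.1 hne).antisymm
    (h.subset_of_meets h'.2.2.1 h'.2.1 (by rwa [Set.inter_comm]))

theorem exists_isCompOf {S : Set V} {x : V} (hx : x ∈ S) : ∃ C, IsCompOf G S C ∧ x ∈ C := by
  set C : Set V := {y | ∃ p : G.Walk x y, ∀ z ∈ p.support, z ∈ S} with hC
  have hxC : x ∈ C := ⟨Walk.nil, by simpa using hx⟩
  refine ⟨C, ⟨⟨x, hxC⟩, ?_, ?_, ?_⟩, hxC⟩
  · rintro y ⟨p, hp⟩
    exact hp y p.end_mem_support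
  · refine induce_connected_of_patches x hxC ?_
    rintro y ⟨p, hp⟩
    refine ⟨{z | z ∈ p.support}, ?_, p.start_mem_support, p.end_mem_support,
      p.connected_induce_support.preconnected _ _⟩
    intro z hz
    classical
    exact ⟨p.takeUntil z hz, fun w hw => hp w (p.support_takeUntil_subset_support hz hw)⟩
  · rintro u ⟨p, hp⟩ v hv huv
    refine ⟨p.concat huv, fun z hz => ?_⟩
    rw [Walk.support_concat] at hz
    simp only [List.mem_append, List.mem_singleton] at hz
    rcases hz with hz | rfl
    · exact hp z hz
    · exact hv

theorem isCompOf_self {S : Set V} (h : (G.induce S).Connected) : IsCompOf G S S :=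
  ⟨Set.nonempty_coe_sort.1 h.nonempty, subset_rfl, h, fun _ _ _ hv _ => hv⟩

/-- A connected set that meets `X` and is not contained in it meets the neighbourhood of `X`. -/
theorem exists_mem_nbhd {X E : Set V} (hE : (G.induce E).Connected) (hne : (E ∩ X).Nonempty)
    (hn : ¬ E ⊆ X) : (E ∩ NbhdSet G X).Nonempty := by
  by_contra hcon
  refine hn (subset_of_connected_of_closed hE hne fun u hu huX v hv huv => ?_)
  by_contra hvX
  exact hcon ⟨v, hv, hvX, u, huX, huv⟩

theorem finite_nbhd_iff {X : Set V} : ord G X ≠ ⊤ ↔ (NbhdSet G X).Finite :=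
  Set.encard_ne_top_iff

/-- If `F ⊆ C` then neighbours of a component of `C \ F` lie in `F` or in the neighbourhood
of `C`. -/
theorem nbhd_comp_subset {C F E : Set V} (hE : IsCompOf G (C \ F) E) :
    NbhdSet G E ⊆ NbhdSet G C ∪ (C ∩ F) := by
  rintro v ⟨h, u, hu, huv⟩
  by_cases hv : v ∈ C
  · by_cases hF : v ∈ F
    · exact Or.inr ⟨hv, hF⟩
    · exact absurd (hE.closedIn u hu v ⟨hv, hF⟩ huv) h
  · exact Or.inl ⟨hv, u, (hE.2.1 hu).1, huv⟩

/-- An ultrafilter is nonprincipal if it contains no finite set. -/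
def Nonprincipal (ω : Ultrafilter V) : Prop := ∀ s : Set V, s.Finite → s ∉ ω

theorem exists_nonprincipal {W : Set V} (hW : W.Infinite) :
    ∃ ω : Ultrafilter V, Nonprincipal ω ∧ W ∈ ω := by
  have : (Filter.cofinite ⊓ Filter.principal W).NeBot := hW.cofinite_inf_principal_neBot
  have hle : ((Ultrafilter.of (Filter.cofinite ⊓ Filter.principal W) : Ultrafilter V) : Filter V)
      ≤ Filter.cofinite ⊓ Filter.principal W := Ultrafilter.of_le _
  refine ⟨Ultrafilter.of (Filter.cofinite ⊓ Filter.principal W), fun s hs hmem => ?_, ?_⟩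
  · have h2 : sᶜ ∈ Ultrafilter.of (Filter.cofinite ⊓ Filter.principal W) :=
      hle (Filter.mem_inf_of_left hs.compl_mem_cofinite)
    exact (Ultrafilter.compl_mem_iff_notMem.1 h2) hmem
  · exact hle (Filter.mem_inf_of_right (Filter.mem_principal_self W))

/-- `B` is the largest set of minimum order among the members of `ω` contained in `C`. -/
structure IsCore (G : SimpleGraph V) (ω : Ultrafilter V) (C B : Set V) : Prop where
  sub : B ⊆ C
  mem : B ∈ ω
  ord_ne_top : ord G B ≠ ⊤
  le_ord : ∀ X ⊆ C, X ∈ ω → ord G B ≤ ord G X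
  max : ∀ X ⊆ C, X ∈ ω → ord G X ≤ ord G B → X ⊆ B

theorem le_of_add_le_add_right {a b c d : ℕ∞} (h : a + b ≤ c + d) (hdb : d ≤ b) (hd : d ≠ ⊤) :
    a ≤ c := by
  have : a + d ≤ c + d := (add_le_add le_rfl hdb).trans h
  exact (ENat.add_le_add_iff_right hd).1 this

theorem exists_isCore {ω : Ultrafilter V} {C X₀ : Set V} (hX₀ : X₀ ⊆ C) (hω : X₀ ∈ ω)
    (hfin : ord G X₀ ≠ ⊤) : ∃ B, IsCore G ω C B ∧ ord G B ≤ ord G X₀ := by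
  obtain ⟨A, ⟨hAC, hAω⟩, hAmin⟩ : ∃ A, (A ⊆ C ∧ A ∈ ω) ∧
      ∀ X, X ⊆ C ∧ X ∈ ω → ord G A ≤ ord G X := by
    obtain ⟨A, hA, hmin⟩ := WellFounded.has_min (InvImage.wf (ord G) wellFounded_lt)
      {X : Set V | X ⊆ C ∧ X ∈ ω} ⟨X₀, hX₀, hω⟩
    exact ⟨A, hA, fun X hX => not_lt.1 (hmin X hX)⟩
  have hA0 : ord G A ≤ ord G X₀ := hAmin _ ⟨hX₀, hω⟩
  have hAtop : ord G A ≠ ⊤ := ne_top_of_le_ne_top hfin hA0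
  set F : Set (Set V) := {X | X ⊆ C ∧ X ∈ ω ∧ ord G X ≤ ord G A} with hF
  have hunion : ∀ X ∈ F, ∀ Y ∈ F, X ∪ Y ∈ F := by
    rintro X ⟨hX, hXω, hXo⟩ Y ⟨hY, hYω, hYo⟩
    refine ⟨Set.union_subset hX hY, Filter.mem_of_superset hXω Set.subset_union_left, ?_⟩
    refine le_of_add_le_add_right ((ord_submodular X Y).trans (add_le_add hXo hYo))
      (hAmin _ ⟨Set.inter_subset_left.trans hX, Filter.inter_mem hXω hYω⟩) hAtop
  have hAF : A ∈ F := ⟨hAC, hAω, le_rfl⟩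
  have hBC : ⋃₀ F ⊆ C := Set.sUnion_subset fun X hX => hX.1
  have hAB : A ⊆ ⋃₀ F := Set.subset_sUnion_of_mem hAF
  have hBω : ⋃₀ F ∈ ω := Filter.mem_of_superset hAω hAB
  have key : ∀ S : Set V, S.Finite → S ⊆ NbhdSet G (⋃₀ F) → ∃ X ∈ F, S ⊆ NbhdSet G X := by
    intro S hS
    induction S, hS using Set.Finite.induction_on with
    | empty => exact fun _ => ⟨A, hAF, Set.empty_subset _⟩
    | @insert s S _ _ ih =>
      intro hsub
      obtain ⟨X, hX, hSX⟩ := ih ((Set.subset_insert _ _).trans hsub)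
      obtain ⟨hs, u, ⟨Y, hY, huY⟩, hus⟩ := hsub (Set.mem_insert _ _)
      refine ⟨X ∪ Y, hunion X hX Y hY, ?_⟩
      have hXY : X ∪ Y ⊆ ⋃₀ F := Set.subset_sUnion_of_mem (hunion X hX Y hY)
      refine Set.insert_subset ⟨fun h => hs (hXY h), u, Or.inr huY, hus⟩ fun v hv => ?_
      obtain ⟨_, w, hw, hwv⟩ := hSX hv
      exact ⟨fun h => (hsub (Or.inr hv)).1 (hXY h), w, Or.inl hw, hwv⟩
  have hBA : ord G (⋃₀ F) ≤ ord G A := by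
    by_contra! hlt
    obtain ⟨S, hS, hScard⟩ := Set.exists_subset_encard_eq (Order.add_one_le_of_lt hlt)
    have hSfin : S.Finite := by
      rw [← Set.encard_ne_top_iff, hScard]
      exact WithTop.add_ne_top.2 ⟨hAtop, ENat.one_ne_top⟩
    obtain ⟨X, hX, hSX⟩ := key S hSfin hS
    have h1 : ord G A + 1 ≤ ord G A :=
      hScard.symm.le.trans ((Set.encard_le_encard hSX).trans hX.2.2)
    exact absurd ((ENat.add_one_le_iff hAtop).1 h1) (lt_irrefl _)
  refine ⟨⋃₀ F, ⟨hBC, hBω, ne_top_of_le_ne_top hAtop hBA,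
    fun X hX hXω => hBA.trans (hAmin X ⟨hX, hXω⟩),
    fun X hX hXω hXo => Set.subset_sUnion_of_mem ⟨hX, hXω, hXo.trans hBA⟩⟩, hBA.trans hA0⟩

theorem IsCore.subset_of_mem {ω ω' : Ultrafilter V} {C B D : Set V} (hB : IsCore G ω C B)
    (hD : IsCore G ω' C D) (h : D ∈ ω) : B ⊆ D := by
  have h1 : ord G (B ∪ D) ≤ ord G D := by
    refine le_of_add_le_add_right (b := ord G (B ∩ D)) (d := ord G B) ?_
      (hB.le_ord _ (Set.inter_subset_left.trans hB.sub) (Filter.inter_mem hB.mem h)) hB.ord_ne_top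
    rw [add_comm (ord G D)]
    exact ord_submodular B D
  exact Set.subset_union_left.trans (hD.max _ (Set.union_subset hB.sub hD.sub)
    (Filter.mem_of_superset hD.mem Set.subset_union_right) h1)

theorem diff_mem_ultrafilter {ω : Ultrafilter V} {X Y : Set V} (hX : X ∈ ω) (hY : Y ∉ ω) :
    X \ Y ∈ ω :=
  Filter.inter_mem hX (Ultrafilter.compl_mem_iff_notMem.2 hY)

theorem Nonprincipal.diff_mem {ω : Ultrafilter V} (hω : Nonprincipal ω) {X Y : Set V}
    (hX : X ∈ ω) (hY : Y ∉ ω) (hYo : ord G Y ≠ ⊤) : X \ (Y ∪ NbhdSet G Y) ∈ ω := by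
  refine diff_mem_ultrafilter hX fun h => ?_
  rcases Ultrafilter.union_mem_iff.1 h with h | h
  · exact hY h
  · exact hω _ (finite_nbhd_iff.1 hYo) h

theorem IsCore.ord_diff_le {ω : Ultrafilter V} {C B X : Set V} (hω : Nonprincipal ω)
    (hB : IsCore G ω C B) (hX : X ∉ ω) : ord G (X \ (B ∪ NbhdSet G B)) ≤ ord G X := by
  rcases eq_or_ne (ord G X) ⊤ with h | h
  · rw [h]; exact le_top
  · exact le_of_add_le_add_right (ord_posimodular X B)
      (hB.le_ord _ (Set.sdiff_subset.trans hB.sub) (hω.diff_mem hB.mem hX h)) hB.ord_ne_top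

/-- Some nonprincipal ultrafilter on an extension of `E` inside `C` certifies that the order of
`E` cannot be undercut. -/
def Robust (G : SimpleGraph V) (C E : Set V) : Prop :=
  ∃ E' : Set V, E ⊆ E' ∧ E' ⊆ C ∧ NbhdSet G E' ⊆ NbhdSet G E ∧
    ∃ ω : Ultrafilter V, Nonprincipal ω ∧ E' ∈ ω ∧ ∀ B ⊆ E', B ∈ ω → ord G E ≤ ord G B

theorem Robust.mono {C C' E : Set V} (h : Robust G C E) (hC : C ⊆ C') : Robust G C' E := by
  obtain ⟨E', h1, h2, h3⟩ := h
  exact ⟨E', h1, h2.trans hC, h3⟩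

/-- Sets of order smaller than `C` can be pushed off `F` without increasing their order. -/
def Pushes (G : SimpleGraph V) (C F : Set V) : Prop :=
  ∀ ω : Ultrafilter V, Nonprincipal ω → ∀ X ⊆ C, X ∈ ω → ord G X < ord G C →
    ∃ Y ⊆ C \ F, Y ∈ ω ∧ ord G Y ≤ ord G X

theorem exists_infinite_fiber {α β : Type*} {s : Set α} (hs : s.Infinite) {t : Set β}
    (ht : t.Finite) (f : α → β) (hf : Set.MapsTo f s t) : ∃ b, (s ∩ f ⁻¹' {b}).Infinite := by
  by_contra! h
  refine hs ((ht.biUnion fun b _ => h b).subset fun a ha => ?_)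
  exact Set.mem_biUnion (hf ha) ⟨ha, rfl⟩

theorem finite_not_robust {C F : Set V} (hC : ord G C ≠ ⊤) (hF : F.Finite) :
    {E | IsCompOf G (C \ F) E ∧ ¬ Robust G C E}.Finite := by
  by_contra hinf
  obtain ⟨S, hS⟩ := exists_infinite_fiber (Set.not_finite.1 hinf)
    ((finite_nbhd_iff.1 hC).union hF).finite_subsets (NbhdSet G)
    (fun E hE => (nbhd_comp_subset hE.1).trans
      (Set.union_subset_union_right _ Set.inter_subset_right))
  set T := {E | IsCompOf G (C \ F) E ∧ ¬ Robust G C E} ∩ NbhdSet G ⁻¹' {S} with hT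
  have hne : ∀ E ∈ T, ∃ x, x ∈ E := fun E hE => hE.1.1.1
  obtain ⟨E₀, hE₀⟩ := hS.nonempty
  have : Nonempty V := ⟨(hne E₀ hE₀).choose⟩
  choose! pt hpt using hne
  have hdisj : ∀ E ∈ T, ∀ E' ∈ T, ∀ x ∈ E, x ∈ E' → E = E' := fun E hE E' hE' x hx hx' =>
    hE.1.1.eq_of_meets hE'.1.1 ⟨x, hx, hx'⟩
  have hinj : Set.InjOn pt T := fun E hE E' hE' h =>
    hdisj E hE E' hE' _ (hpt E hE) (h ▸ hpt E' hE')
  obtain ⟨ω, hω, hW⟩ := exists_nonprincipal (hS.image hinj)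
  have hNS : ∀ E ∈ T, NbhdSet G E = S := fun E hE => hE.2
  have hSout : ∀ v ∈ S, v ∉ ⋃₀ T := by
    rintro v hv ⟨E, hE, hvE⟩
    rw [← hNS E hE] at hv
    exact hv.1 hvE
  refine hE₀.1.2 ⟨⋃₀ T, Set.subset_sUnion_of_mem hE₀,
    Set.sUnion_subset fun E hE => hE.1.1.2.1.trans Set.sdiff_subset, ?_, ω, hω, ?_, ?_⟩
  · rintro v ⟨hv, u, ⟨E, hE, huE⟩, huv⟩
    rw [hNS _ hE₀, ← hNS E hE]
    exact ⟨fun h => hv ⟨E, hE, h⟩, u, huE, huv⟩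
  · refine Filter.mem_of_superset hW ?_
    rintro _ ⟨E, hE, rfl⟩
    exact ⟨E, hE, hpt E hE⟩
  · intro B hB hBω
    rcases eq_or_ne (ord G B) ⊤ with h | h
    · rw [h]; exact le_top
    obtain ⟨E, hE, hEB, hEN⟩ : ∃ E ∈ T, pt E ∈ B ∧ ¬ (E ∩ NbhdSet G B).Nonempty := by
      by_contra! hcon
      choose! q hq using hcon
      have hinf' : (T ∩ pt ⁻¹' B).Infinite := by
        intro hfin
        refine hω _ (hfin.image pt) (Filter.mem_of_superset (Filter.inter_mem hW hBω) ?_)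
        rintro _ ⟨⟨E, hE, rfl⟩, hEB⟩
        exact ⟨E, ⟨hE, hEB⟩, rfl⟩
      refine Set.infinite_of_injOn_mapsTo (f := q) ?_ ?_ hinf' (finite_nbhd_iff.1 h)
      · intro E hE E' hE' h
        exact hdisj E hE.1 E' hE'.1 _ (hq E hE.1 hE.2).1 (h ▸ (hq E' hE'.1 hE'.2).1)
      · exact fun E hE => (hq E hE.1 hE.2).2
    have hsub : E ⊆ B := by
      by_contra hcon
      exact hEN (exists_mem_nbhd hE.1.1.2.2.1 ⟨pt E, hpt E hE, hEB⟩ hcon)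
    refine ord_mono ?_
    rw [hNS _ hE₀]
    intro v hv
    have hv' := hv
    rw [← hNS E hE] at hv'
    obtain ⟨_, u, hu, huv⟩ := hv'
    exact ⟨fun h => hSout v hv (hB h), u, hsub hu, huv⟩

theorem exists_pushes_of_components {C F₀ : Set V} (hF₀ : F₀ ⊆ C) (hfin : F₀.Finite)
    (hC : ord G C ≠ ⊤) (hpush : Pushes G C F₀)
    (h : ∀ E, IsCompOf G (C \ F₀) E → ¬ Robust G C E → ∃ F ⊆ E, F.Finite ∧ Pushes G E F ∧
      ∀ E', IsCompOf G (E \ F) E' → Robust G E E' ∧ ord G E' ≤ ord G E) :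
    ∃ F ⊆ C, F.Finite ∧ F₀ ⊆ F ∧ Pushes G C F ∧ ∀ E', IsCompOf G (C \ F) E' →
      Robust G C E' ∧ ∃ E, IsCompOf G (C \ F₀) E ∧ E' ⊆ E ∧ ord G E' ≤ ord G E := by
  choose! f hf hffin hfpush hfcomp using h
  set T := {E | IsCompOf G (C \ F₀) E ∧ ¬ Robust G C E} with hT
  have hTfin : T.Finite := finite_not_robust hC hfin
  have hfC : ∀ E ∈ T, f E ⊆ C := fun E hE =>
    (hf E hE.1 hE.2).trans (hE.1.2.1.trans Set.sdiff_subset)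
  have hout : ∀ E, IsCompOf G (C \ F₀) E → ∀ v ∈ E, v ∉ f E ∨ E ∉ T →
      v ∈ C \ (F₀ ∪ ⋃ E ∈ T, f E) := by
    intro E hE v hv hvE
    refine ⟨(hE.2.1 hv).1, ?_⟩
    rintro (hv' | hv')
    · exact (hE.2.1 hv).2 hv'
    · obtain ⟨E', hE', hvE'⟩ := Set.mem_iUnion₂.1 hv'
      have := hE.eq_of_meets hE'.1 ⟨v, hv, hf E' hE'.1 hE'.2 hvE'⟩
      subst this
      exact hvE.elim (fun h => h hvE') fun h => h hE'
  refine ⟨F₀ ∪ ⋃ E ∈ T, f E, Set.union_subset hF₀ (Set.iUnion₂_subset hfC),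
    hfin.union (hTfin.biUnion fun E hE => hffin E hE.1 hE.2), Set.subset_union_left, ?_, ?_⟩
  · intro ω hω X hX hXω hXo
    obtain ⟨Y, hY, hYω, hYo⟩ := hpush ω hω X hX hXω hXo
    by_cases hE : ∃ E ∈ T, E ∈ ω
    · obtain ⟨E, hE, hEω⟩ := hE
      have hYE : ord G (Y ∩ E) ≤ ord G X := (ord_inter_le hE.1.closedIn hY).trans hYo
      obtain ⟨Z, hZE, hZω, hZo, hZX⟩ : ∃ Z ⊆ E, Z ∈ ω ∧ ord G Z < ord G E ∧
          ord G Z ≤ ord G X := by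
        rcases lt_or_ge (ord G (Y ∩ E)) (ord G E) with hlt | hge
        · exact ⟨Y ∩ E, Set.inter_subset_right, Filter.inter_mem hYω hEω, hlt, hYE⟩
        · have hnr := hE.2
          by_contra! hcon
          refine hnr ⟨E, subset_rfl, hE.1.2.1.trans Set.sdiff_subset, subset_rfl, ω, hω, hEω,
            fun B hB hBω => ?_⟩
          by_contra! hlt
          exact absurd (hlt.le.trans (hge.trans hYE)) (not_le.2 (hcon B hB hBω hlt))
      obtain ⟨Y', hY', hY'ω, hY'o⟩ := hfpush E hE.1 hE.2 ω hω Z hZE hZω hZo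
      exact ⟨Y', fun v hv => hout E hE.1 v (hY' hv).1 (Or.inl (hY' hv).2), hY'ω,
        hY'o.trans hZX⟩
    · push Not at hE
      have hcl : ClosedIn G (C \ F₀) ((C \ F₀) \ ⋃₀ T) := by
        rintro u ⟨hu, huT⟩ v hv huv
        refine ⟨hv, ?_⟩
        rintro ⟨E, hE, hvE⟩
        exact huT ⟨E, hE, hE.1.closedIn v hvE u hu huv.symm⟩
      have hTω : ⋃₀ T ∉ ω := by
        intro hmem
        obtain ⟨E, hE', hEω⟩ := (Ultrafilter.finite_sUnion_mem_iff hTfin).1 hmem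
        exact hE E hE' hEω
      refine ⟨Y ∩ ((C \ F₀) \ ⋃₀ T), ?_, ?_, (ord_inter_le hcl hY).trans hYo⟩
      · rintro v ⟨_, hv, hvT⟩
        refine ⟨hv.1, ?_⟩
        rintro (hv' | hv')
        · exact hv.2 hv'
        · obtain ⟨E', hE', hvE'⟩ := Set.mem_iUnion₂.1 hv'
          exact hvT ⟨E', hE', hf E' hE'.1 hE'.2 hvE'⟩
      · exact Filter.inter_mem hYω
          (diff_mem_ultrafilter (Filter.mem_of_superset hYω hY) hTω)
  · intro E' hE'
    obtain ⟨x, hx⟩ := hE'.1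
    have hE'sub : E' ⊆ C \ F₀ := hE'.2.1.trans fun v hv => ⟨hv.1, fun h => hv.2 (Or.inl h)⟩
    obtain ⟨E, hE, hxE⟩ := exists_isCompOf (G := G) (hE'sub hx)
    have hE'E : E' ⊆ E := hE.subset_of_meets hE'.2.2.1 hE'sub ⟨x, hx, hxE⟩
    by_cases hr : Robust G C E
    · have hEE' : E ⊆ E' := hE'.subset_of_meets hE.2.2.1
        (fun v hv => hout E hE v hv (Or.inr fun h => h.2 hr)) ⟨x, hxE, hx⟩
      obtain rfl := hEE'.antisymm hE'E
      exact ⟨hr, E, hE, subset_rfl, le_rfl⟩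
    · have hcomp : IsCompOf G (E \ f E) E' := by
        refine ⟨hE'.1, fun v hv => ⟨hE'E hv, fun h => (hE'.2.1 hv).2
          (Or.inr (Set.mem_biUnion (show E ∈ T from ⟨hE, hr⟩) h))⟩, hE'.2.2.1, ?_⟩
        intro u hu v hv huv
        exact hE'.closedIn u hu v (hout E hE v hv.1 (Or.inl hv.2)) huv
      obtain ⟨h1, h2⟩ := hfcomp E hE hr E' hcomp
      exact ⟨h1.mono (hE.2.1.trans Set.sdiff_subset), E, hE, hE'E, h2⟩

theorem ord_comp_ne_top {C F E : Set V} (hC : ord G C ≠ ⊤) (hF : F.Finite)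
    (hE : IsCompOf G (C \ F) E) : ord G E ≠ ⊤ :=
  finite_nbhd_iff.2 (((finite_nbhd_iff.1 hC).union hF).subset ((nbhd_comp_subset hE).trans
    (Set.union_subset_union_right _ Set.inter_subset_right)))

theorem ord_diff_biUnion_le {C X : Set V} {K : Set (Set V)} (hK : K.Finite)
    (h : ∀ B ∈ K, ∃ ω, Nonprincipal ω ∧ IsCore G ω C B ∧ X ∉ ω) :
    ord G (X \ ⋃ B ∈ K, (B ∪ NbhdSet G B)) ≤ ord G X := by
  induction K, hK using Set.Finite.induction_on with
  | empty => simp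
  | @insert B K _ _ ih =>
    have ih' := ih fun B' hB' => h B' (Set.mem_insert_of_mem _ hB')
    obtain ⟨ω, hω, hB, hX⟩ := h B (Set.mem_insert _ _)
    rw [Set.biUnion_insert, Set.union_comm, ← Set.sdiff_sdiff]
    exact (hB.ord_diff_le hω fun hmem =>
      hX (Filter.mem_of_superset hmem Set.sdiff_subset)).trans ih'

/-- If a family of sets meets every nonprincipal ultrafilter on `A`, then finitely many of its
members cover `A` up to a finite set. -/
theorem exists_finite_cover {A : Set V} {F : Set (Set V)}
    (h : ∀ ω : Ultrafilter V, Nonprincipal ω → A ∈ ω → ∃ B ∈ F, B ∈ ω) :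
    ∃ S ⊆ F, S.Finite ∧ (A \ ⋃₀ S).Finite := by
  by_contra! hcon
  let f : Filter V := Filter.comk (fun t => ∃ S ⊆ F, S.Finite ∧ ((A ∩ t) \ ⋃₀ S).Finite)
    ⟨∅, Set.empty_subset _, Set.finite_empty, by simp⟩
    (fun t ⟨S, hS, hfin, ht⟩ s hst => ⟨S, hS, hfin, ht.subset (by gcongr)⟩)
    (fun s ⟨S, hS, hSfin, hs⟩ t ⟨S', hS', hS'fin, ht⟩ =>
      ⟨S ∪ S', Set.union_subset hS hS', hSfin.union hS'fin, (hs.union ht).subset (by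
        rintro x ⟨⟨hA, hx⟩, hxS⟩
        rw [Set.sUnion_union] at hxS
        rcases hx with hx | hx
        · exact Or.inl ⟨⟨hA, hx⟩, fun h => hxS (Or.inl h)⟩
        · exact Or.inr ⟨⟨hA, hx⟩, fun h => hxS (Or.inr h)⟩)⟩)
  have hf : ∀ t, t ∈ f ↔ ∃ S ⊆ F, S.Finite ∧ ((A ∩ tᶜ) \ ⋃₀ S).Finite := fun t => Iff.rfl
  have hne : f.NeBot := by
    refine ⟨fun hbot => ?_⟩
    have : (∅ : Set V) ∈ f := hbot ▸ Filter.mem_bot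
    obtain ⟨S, hS, hSfin, hfin⟩ := (hf _).1 this
    exact hcon S hS hSfin (by simpa using hfin)
  have hle : ∀ t ∈ f, t ∈ Ultrafilter.of f := fun t ht => Ultrafilter.of_le f ht
  have hcompl : ∀ t, tᶜ ∈ f → t ∉ Ultrafilter.of f := fun t ht =>
    Ultrafilter.compl_mem_iff_notMem.1 (hle _ ht)
  obtain ⟨B, hB, hBω⟩ := h (Ultrafilter.of f)
    (fun s hs => hcompl s ((hf _).2 ⟨∅, Set.empty_subset _, Set.finite_empty, by
      rw [compl_compl]; exact hs.subset (Set.sdiff_subset.trans Set.inter_subset_right)⟩))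
    (hle A ((hf _).2 ⟨∅, Set.empty_subset _, Set.finite_empty, by simp⟩))
  exact hcompl B ((hf _).2 ⟨{B}, by simpa using hB, Set.finite_singleton _, by
    rw [compl_compl, Set.sUnion_singleton, Set.inter_sdiff_assoc]; simp⟩) hBω

theorem exists_pushes_of_not_robust {A : Set V} (hne : A.Nonempty) (hr : ¬ Robust G A A) :
    ∃ F ⊆ A, F.Finite ∧ Pushes G A F ∧ ∀ E, IsCompOf G (A \ F) E → ord G E < ord G A := by
  have hcore : ∀ ω : Ultrafilter V, Nonprincipal ω → A ∈ ω →
      ∃ B, IsCore G ω A B ∧ ord G B < ord G A := by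
    intro ω hω hAω
    obtain ⟨X, hX, hXω, hXo⟩ : ∃ X ⊆ A, X ∈ ω ∧ ord G X < ord G A := by
      by_contra! hcon
      exact hr ⟨A, subset_rfl, subset_rfl, subset_rfl, ω, hω, hAω, hcon⟩
    obtain ⟨B, hB, hBo⟩ := exists_isCore hX hXω hXo.ne_top
    exact ⟨B, hB, hBo.trans_lt hXo⟩
  obtain ⟨S, hSF, hS, hcov⟩ := exists_finite_cover (A := A)
    (F := {B | ∃ ω, Nonprincipal ω ∧ IsCore G ω A B ∧ ord G B < ord G A}) (by
      intro ω hω hAω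
      obtain ⟨B, hB, hBo⟩ := hcore ω hω hAω
      exact ⟨B, ⟨ω, hω, hB, hBo⟩, hB.mem⟩)
  set M := {B | Maximal (· ∈ S) B} with hM
  have hMS : M ⊆ S := fun B hB => hB.prop
  have hMfin : M.Finite := hS.subset hMS
  have hMmax : ∀ K ∈ M, ∀ B ∈ M, K ⊆ B → K = B := fun K hK B hB h =>
    h.antisymm (hK.le_of_ge hB.prop h)
  have : Nonempty (Ultrafilter V) := ⟨pure hne.some⟩
  have hcores : ∀ B ∈ S, ∃ ω, Nonprincipal ω ∧ IsCore G ω A B ∧ ord G B < ord G A :=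
    fun B hB => hSF hB
  choose! ω hω hωcore hωord using hcores
  let R : Set V → Set V → Prop := WellOrderingRel
  let W : Set V → Set V := fun B => ⋃ K ∈ {K ∈ M | R K B}, (K ∪ NbhdSet G K)
  let m : Set V → Set V := fun B => B \ W B
  have hnotmem : ∀ B ∈ M, ∀ K ∈ M, R K B → ∀ D ⊆ B, ∀ ω', IsCore G ω' A D → D ∉ ω K := by
    intro B hB K hK hKB D hD ω' hDc hmem
    have hKD : K ⊆ D := (hωcore _ (hMS hK)).subset_of_mem hDc hmem
    have := hMmax K hK B hB (hKD.trans hD)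
    subst this
    exact irrefl_of WellOrderingRel K hKB
  have hWle : ∀ B ∈ M, ∀ D ⊆ B, ∀ ω', IsCore G ω' A D → ord G (D \ W B) ≤ ord G D := by
    intro B hB D hD ω' hDc
    refine ord_diff_biUnion_le (C := A) (hMfin.subset fun K hK => hK.1) fun K hK => ?_
    exact ⟨ω K, hω _ (hMS hK.1), hωcore _ (hMS hK.1), hnotmem B hB K hK.1 hK.2 D hD ω' hDc⟩
  have hsep : ∀ B ∈ M, ∀ B' ∈ M, B ≠ B' → ∀ x ∈ m B, ∀ y ∈ m B', x ≠ y ∧ ¬ G.Adj x y := by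
    have aux : ∀ B ∈ M, ∀ B' ∈ M, R B B' → ∀ x ∈ m B, ∀ y ∈ m B', x ≠ y ∧ ¬ G.Adj x y := by
      intro B hB B' hB' hBB' x hx y hy
      have hyB : y ∉ B ∪ NbhdSet G B := fun h =>
        hy.2 (Set.mem_biUnion (show B ∈ {K ∈ M | R K B'} from ⟨hB, hBB'⟩) h)
      refine ⟨?_, fun hxy => hyB (Or.inr ⟨fun h => hyB (Or.inl h), x, hx.1, hxy⟩)⟩
      rintro rfl
      exact hyB (Or.inl hx.1)
    intro B hB B' hB' hne x hx y hy
    rcases trichotomous_of WellOrderingRel B B' with h | h | h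
    · exact aux B hB B' hB' h x hx y hy
    · exact absurd h hne
    · obtain ⟨h1, h2⟩ := aux B' hB' B hB h y hy x hx
      exact ⟨h1.symm, fun h => h2 h.symm⟩
  have hmA : ∀ B ∈ M, m B ⊆ A := fun B hB => Set.sdiff_subset.trans (hωcore _ (hMS hB)).sub
  have hF₀ : (A \ ⋃ B ∈ M, m B).Finite := by
    refine (hcov.union (hMfin.biUnion (t := NbhdSet G) fun K hK =>
      finite_nbhd_iff.1 (hωcore _ (hMS hK)).ord_ne_top)).subset ?_
    rintro v ⟨hvA, hv⟩
    by_cases hvS : v ∈ ⋃₀ S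
    · right
      obtain ⟨B₀, hB₀, hvB₀⟩ := hvS
      obtain ⟨B₁, hB₀₁, hB₁⟩ := hS.exists_le_maximal hB₀
      obtain ⟨B, ⟨hB, hvB⟩, hmin⟩ := WellFounded.has_min
        (WellOrderingRel.isWellOrder (α := Set V)).wf {B | B ∈ M ∧ v ∈ B} ⟨B₁, hB₁, hB₀₁ hvB₀⟩
      have hvW : v ∈ W B := by
        by_contra hcon
        exact hv (Set.mem_biUnion hB ⟨hvB, hcon⟩)
      obtain ⟨K, ⟨hK, hKB⟩, hvK⟩ := Set.mem_iUnion₂.1 hvW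
      rcases hvK with hvK | hvK
      · exact absurd hKB (hmin K ⟨hK, hvK⟩)
      · exact Set.mem_biUnion hK hvK
    · exact Or.inl ⟨hvA, hvS⟩
  have hdiff : A \ (A \ ⋃ B ∈ M, m B) = ⋃ B ∈ M, m B := by
    rw [Set.sdiff_sdiff_cancel_left (Set.iUnion₂_subset hmA)]
  refine ⟨A \ ⋃ B ∈ M, m B, Set.sdiff_subset, hF₀, ?_, ?_⟩
  · intro ω' hω' X hX hXω hXo
    have hmem : (⋃ B ∈ M, m B) ∈ ω' := by
      rw [← hdiff]
      exact diff_mem_ultrafilter (Filter.mem_of_superset hXω hX) (hω' _ hF₀)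
    obtain ⟨B, hB, hBω⟩ := (Ultrafilter.finite_biUnion_mem_iff hMfin).1 hmem
    obtain ⟨D, hD, hDo⟩ := exists_isCore hX hXω hXo.ne_top
    have hDB : D ⊆ B := hD.subset_of_mem (hωcore _ (hMS hB))
      (Filter.mem_of_superset hBω Set.sdiff_subset)
    rw [hdiff]
    refine ⟨D \ W B, fun v hv => Set.mem_biUnion hB ⟨hDB hv.1, hv.2⟩, ?_,
      (hWle B hB D hDB ω' hD).trans hDo⟩
    exact Filter.mem_of_superset (Filter.inter_mem hD.mem hBω) fun v hv => ⟨hv.1, hv.2.2⟩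
  · intro E hE
    rw [hdiff] at hE
    obtain ⟨x, hx⟩ := hE.1
    obtain ⟨B, hB, hxB⟩ := Set.mem_iUnion₂.1 (hE.2.1 hx)
    have hEB : E ⊆ m B := by
      refine subset_of_connected_of_closed hE.2.2.1 ⟨x, hx, hxB⟩ fun u _ huB v hv huv => ?_
      obtain ⟨B', hB', hvB'⟩ := Set.mem_iUnion₂.1 (hE.2.1 hv)
      by_cases hBB' : B = B'
      · rwa [hBB']
      · exact absurd huv (hsep B hB B' hB' hBB' u huB v hvB').2
    refine lt_of_le_of_lt (ord_mono ?_)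
      ((hWle B hB B subset_rfl _ (hωcore _ (hMS hB))).trans_lt (hωord _ (hMS hB)))
    rintro v ⟨hv, u, hu, huv⟩
    exact ⟨fun h => hv (hE.closedIn u hu v (Set.mem_biUnion hB h) huv), u, hEB hu, huv⟩

theorem exists_robust_components {A : Set V} (hconn : (G.induce A).Connected)
    (hA : ord G A ≠ ⊤) : ∃ F ⊆ A, F.Finite ∧ Pushes G A F ∧
      ∀ E, IsCompOf G (A \ F) E → Robust G A E ∧ ord G E ≤ ord G A := by
  induction hn : ord G A using WellFoundedLT.induction generalizing A with
  | ind n ih =>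
  subst hn
  by_cases hr : Robust G A A
  · refine ⟨∅, Set.empty_subset _, Set.finite_empty, ?_, ?_⟩
    · exact fun ω hω X hX hXω _ => ⟨X, by simpa using hX, hXω, le_rfl⟩
    · intro E hE
      rw [Set.sdiff_empty] at hE
      obtain rfl := hE.eq_of_meets (isCompOf_self hconn)
        (by rw [Set.inter_eq_left.2 hE.2.1]; exact hE.1)
      exact ⟨hr, le_rfl⟩
  · obtain ⟨F₀, hF₀, hfin, hpush, hlt⟩ := exists_pushes_of_not_robust
      (Set.nonempty_coe_sort.1 hconn.nonempty) hr
    obtain ⟨F, hF, hFfin, _, hFpush, hcomp⟩ := exists_pushes_of_components hF₀ hfin hA hpush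
      fun E hE _ => ih (ord G E) (hlt E hE) hE.2.2.1 (ord_comp_ne_top hA hfin hE) rfl
    refine ⟨F, hF, hFfin, hFpush, fun E' hE' => ?_⟩
    obtain ⟨h1, E, hE, _, h2⟩ := hcomp E' hE'
    exact ⟨h1, h2.trans (hlt E hE).le⟩

theorem exists_isCore_maximal_ord {C : Set V} {u : V} (hC : ord G C ≠ ⊤)
    (h : ∃ ω B, Nonprincipal ω ∧ IsCore G ω C B ∧ ord G B < ord G C ∧ u ∈ B) :
    ∃ ω B, Nonprincipal ω ∧ IsCore G ω C B ∧ ord G B < ord G C ∧ u ∈ B ∧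
      ∀ ω' D, Nonprincipal ω' → IsCore G ω' C D → ord G D < ord G C → u ∈ D →
        ord G D ≤ ord G B := by
  set S : Set ℕ := {n | ∃ ω B, Nonprincipal ω ∧ IsCore G ω C B ∧ ord G B < ord G C ∧ u ∈ B ∧
    ord G B = n} with hS
  have hne : S.Nonempty := by
    obtain ⟨ω, B, hω, hB, hlt, hu⟩ := h
    obtain ⟨n, hn⟩ := ENat.ne_top_iff_exists.1 hB.ord_ne_top
    exact ⟨n, ω, B, hω, hB, hlt, hu, hn.symm⟩
  have hbdd : BddAbove S := by
    obtain ⟨n, hn⟩ := ENat.ne_top_iff_exists.1 hC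
    refine ⟨n, ?_⟩
    rintro k ⟨ω, B, hω, hB, hlt, hu, hk⟩
    rw [hk, ← hn] at hlt
    exact_mod_cast hlt.le
  obtain ⟨ω, B, hω, hB, hlt, hu, hk⟩ := Nat.sSup_mem hne hbdd
  refine ⟨ω, B, hω, hB, hlt, hu, fun ω' D hω' hD hDlt huD => ?_⟩
  obtain ⟨n, hn⟩ := ENat.ne_top_iff_exists.1 hD.ord_ne_top
  rw [hk, ← hn]
  exact_mod_cast le_csSup hbdd (show n ∈ S from ⟨ω', D, hω', hD, hDlt, huD, hn.symm⟩)

theorem exists_part {C : Set V} {u : V} (hconn : (G.induce C).Connected) (hC : ord G C ≠ ⊤)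
    (hu : u ∈ C) : ∃ F ⊆ C, F.Finite ∧ F.Nonempty ∧ Pushes G C F ∧
      ∀ E, IsCompOf G (C \ F) E → Robust G C E ∧ (u ∈ E → ord G E < ord G C) := by
  suffices h : ∃ F ⊆ C, F.Finite ∧ Pushes G C F ∧
      ∀ E, IsCompOf G (C \ F) E → Robust G C E ∧ (u ∈ E → ord G E < ord G C) by
    obtain ⟨F, hF, hfin, hpush, hcomp⟩ := h
    refine ⟨F, hF, hfin, ?_, hpush, hcomp⟩
    rw [Set.nonempty_iff_ne_empty]
    rintro rfl
    exact lt_irrefl _ ((hcomp C (by simpa using isCompOf_self hconn)).2 hu)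
  have hR : ∀ F₀ : Set V, F₀.Finite → ∀ E, IsCompOf G (C \ F₀) E → ¬ Robust G C E →
      ∃ F ⊆ E, F.Finite ∧ Pushes G E F ∧
        ∀ E', IsCompOf G (E \ F) E' → Robust G E E' ∧ ord G E' ≤ ord G E := fun F₀ hfin E hE _ =>
    exists_robust_components hE.2.2.1 (ord_comp_ne_top hC hfin hE)
  by_cases hB : ∃ ω B, Nonprincipal ω ∧ IsCore G ω C B ∧ ord G B < ord G C ∧ u ∈ B
  · obtain ⟨ωB, B, hωB, hB, hBC, huB, hmax⟩ := exists_isCore_maximal_ord hC hB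
    have hBsub : B ⊆ C \ (NbhdSet G B ∩ C) := fun v hv => ⟨hB.sub hv, fun h => h.1.1 hv⟩
    have hfin : (NbhdSet G B ∩ C).Finite :=
      (finite_nbhd_iff.1 hB.ord_ne_top).subset Set.inter_subset_left
    have hpush : Pushes G C (NbhdSet G B ∩ C) := by
      intro ω hω X hX hXω hXo
      obtain ⟨D, hD, hDo⟩ := exists_isCore hX hXω hXo.ne_top
      by_cases hBω : B ∈ ω
      · exact ⟨D, (hD.subset_of_mem hB hBω).trans hBsub, hD.mem, hDo⟩
      · have hDB : D ∉ ωB := by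
          intro hmem
          have h1 : B ⊆ D := hB.subset_of_mem hD hmem
          have h2 : D ⊆ B := hB.max D hD.sub hmem (hmax ω D hω hD (hDo.trans_lt hXo) (h1 huB))
          exact hBω (h1.antisymm h2 ▸ hD.mem)
        exact ⟨D \ (B ∪ NbhdSet G B), fun v hv => ⟨hD.sub hv.1, fun h => hv.2 (Or.inr h.1)⟩,
          hω.diff_mem hD.mem hBω hB.ord_ne_top, (hB.ord_diff_le hωB hDB).trans hDo⟩
    obtain ⟨F, hF, hFfin, hF₀, hFpush, hcomp⟩ := exists_pushes_of_components
      Set.inter_subset_right hfin hC hpush (hR _ hfin)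
    refine ⟨F, hF, hFfin, hFpush, fun E' hE' => ?_⟩
    obtain ⟨h1, E, hE, hE'E, h2⟩ := hcomp E' hE'
    refine ⟨h1, fun huE' => h2.trans_lt ?_⟩
    have hEB : E ⊆ B := by
      by_contra hcon
      obtain ⟨v, hvE, hvB⟩ := exists_mem_nbhd hE.2.2.1 ⟨u, hE'E huE', huB⟩ hcon
      exact (hE.2.1 hvE).2 ⟨hvB, (hE.2.1 hvE).1⟩
    refine lt_of_le_of_lt (ord_mono ?_) hBC
    rintro v ⟨hv, w, hw, hwv⟩
    exact ⟨fun h => hv (hE.closedIn w hw v (hBsub h) hwv), w, hEB hw, hwv⟩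
  · have hpush : Pushes G C {u} := by
      intro ω hω X hX hXω hXo
      obtain ⟨D, hD, hDo⟩ := exists_isCore hX hXω hXo.ne_top
      refine ⟨D, fun v hv => ⟨hD.sub hv, ?_⟩, hD.mem, hDo⟩
      rintro rfl
      exact hB ⟨ω, D, hω, hD, hDo.trans_lt hXo, hv⟩
    obtain ⟨F, hF, hFfin, hF₀, hFpush, hcomp⟩ := exists_pushes_of_components
      (Set.singleton_subset_iff.2 hu) (Set.finite_singleton u) hC hpush
      (hR _ (Set.finite_singleton u))
    refine ⟨F, hF, hFfin, hFpush, fun E' hE' => ⟨(hcomp E' hE').1, fun huE' => ?_⟩⟩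
    exact absurd (hF₀ rfl) (hE'.2.1 huE').2

theorem exists_ord_le_of_chain {C F : ℕ → Set V} {n : ℕ}
    (hcomp : ∀ i < n, IsCompOf G (C i \ F i) (C (i + 1)))
    (hpush : ∀ i < n, Pushes G (C i) (F i)) (hrob : ∀ i < n, Robust G (C i) (C (i + 1)))
    {X : Set V} (hn : C n ⊆ X) (h0 : X ⊆ C 0) : ∃ i ≤ n, ord G (C i) ≤ ord G X := by
  by_contra! hlt
  rcases n with _ | m
  · exact absurd (hlt 0 le_rfl) (by rw [hn.antisymm h0]; exact lt_irrefl _)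
  obtain ⟨E, hCE, hEC, hNE, ω, hω, hEω, hmin⟩ := hrob m (Nat.lt_succ_self m)
  have hanti : ∀ i j, i ≤ j → j ≤ m + 1 → C j ⊆ C i := by
    intro i j hij
    induction j, hij using Nat.le_induction with
    | base => exact fun _ => subset_rfl
    | succ j _ ih =>
      exact fun hj => ((hcomp j hj).2.1.trans Set.sdiff_subset).trans (ih (Nat.le_of_succ_le hj))
  have hY : ∀ i ≤ m, ∃ Y ⊆ C i, Y ∈ ω ∧ ord G Y ≤ ord G X := by
    intro i
    induction i with
    | zero =>
      refine fun _ => ⟨X ∪ E,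
        Set.union_subset h0 (hEC.trans (hanti 0 m (Nat.zero_le m) (Nat.le_succ m))),
        Filter.mem_of_superset hEω Set.subset_union_right, ord_mono ?_⟩
      rintro v ⟨hv, u, hu | hu, huv⟩
      · exact ⟨fun h => hv (Or.inl h), u, hu, huv⟩
      · obtain ⟨_, w, hw, hwv⟩ := hNE ⟨fun h => hv (Or.inr h), u, hu, huv⟩
        exact ⟨fun h => hv (Or.inl h), w, hn hw, hwv⟩
    | succ i ih =>
      intro hi
      obtain ⟨Y, hYC, hYω, hYo⟩ := ih (Nat.le_of_succ_le hi)
      obtain ⟨Z, hZ, hZω, hZo⟩ := hpush i (by omega) ω hω Y hYC hYω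
        (hYo.trans_lt (hlt i (by omega)))
      refine ⟨Z ∩ C (i + 1), Set.inter_subset_right, Filter.inter_mem hZω
        (Filter.mem_of_superset hEω (hEC.trans (hanti _ _ hi (Nat.le_succ m)))), ?_⟩
      exact (ord_inter_le (hcomp i (by omega)).closedIn hZ).trans (hZo.trans hYo)
  obtain ⟨Y, hYC, hYω, hYo⟩ := hY m le_rfl
  obtain ⟨Z, hZ, hZω, hZo⟩ := hpush m (Nat.lt_succ_self m) ω hω Y hYC hYω
    (hYo.trans_lt (hlt m (Nat.le_succ m)))
  have hcl : ClosedIn G (C m \ F m) E := by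
    intro u hu v hv huv
    by_contra hvE
    rcases nbhd_comp_subset (hcomp m (Nat.lt_succ_self m)) (hNE ⟨hvE, u, hu, huv⟩) with h | h
    · exact h.1 hv.1
    · exact hv.2 h.2
  have h1 := hmin (Z ∩ E) Set.inter_subset_right (Filter.inter_mem hZω hEω)
  exact absurd (h1.trans ((ord_inter_le hcl hZ).trans (hZo.trans hYo)))
    (not_le.2 (hlt (m + 1) le_rfl))

theorem connAvoiding_refl {S : Set V} {u : V} (hu : u ∉ S) : ConnAvoiding G S u u :=
  ⟨Walk.nil, by simpa using hu⟩

theorem _root_.ConnAvoiding.symm {S : Set V} {u v : V} (h : ConnAvoiding G S u v) :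
    ConnAvoiding G S v u := by
  obtain ⟨p, hp⟩ := h
  exact ⟨p.reverse, by simpa using hp⟩

theorem _root_.ConnAvoiding.trans {S : Set V} {u v w : V} (h : ConnAvoiding G S u v)
    (h' : ConnAvoiding G S v w) : ConnAvoiding G S u w := by
  obtain ⟨p, hp⟩ := h
  obtain ⟨q, hq⟩ := h'
  refine ⟨p.append q, fun x hx => ?_⟩
  rw [Walk.mem_support_append_iff] at hx
  exact hx.elim (hp x) (hq x)

theorem _root_.SimpleGraph.Adj.connAvoiding {S : Set V} {u v : V} (h : G.Adj u v) (hu : u ∉ S)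
    (hv : v ∉ S) : ConnAvoiding G S u v := ⟨h.toWalk, by simp [hu, hv]⟩

theorem _root_.ConnAvoiding.left_notMem {S : Set V} {u v : V} (h : ConnAvoiding G S u v) :
    u ∉ S := h.choose_spec u h.choose.start_mem_support

theorem _root_.ConnAvoiding.right_notMem {S : Set V} {u v : V} (h : ConnAvoiding G S u v) :
    v ∉ S := h.choose_spec v h.choose.end_mem_support

theorem _root_.ConnAvoiding.anti {S S' : Set V} {u v : V} (h : ConnAvoiding G S u v)
    (hS : S' ⊆ S) : ConnAvoiding G S' u v :=
  h.imp fun _ hp x hx hxS => hp x hx (hS hxS)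

theorem _root_.ConnAvoiding.mono {G' : SimpleGraph V} {S : Set V} {u v : V}
    (h : ConnAvoiding G S u v) (hG : G ≤ G') : ConnAvoiding G' S u v := by
  obtain ⟨p, hp⟩ := h
  exact ⟨p.mapLe hG, by simpa using hp⟩

/-- Vertices that can be reached from `A` without meeting `S`. -/
def Reach (G : SimpleGraph V) (S A : Set V) : Set V := {v | ∃ a ∈ A, ConnAvoiding G S a v}

theorem Reach.step {S A : Set V} {u v : V} (hu : u ∈ Reach G S A) (h : G.Adj u v)
    (hv : v ∉ S) : v ∈ Reach G S A := by
  obtain ⟨a, ha, hau⟩ := hu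
  exact ⟨a, ha, hau.trans (h.connAvoiding hau.right_notMem hv)⟩

/-- Some `A`–`B` walk stays inside `P`. -/
def Joins (G : SimpleGraph V) (A B P : Set V) : Prop := ∃ a ∈ A, ∃ b ∈ B, ConnAvoiding G Pᶜ a b

/-- A family of disjoint sets each containing an `A`–`B` walk. -/
def Linkage (G : SimpleGraph V) (A B : Set V) (ι : Type*) : Prop :=
  ∃ P : ι → Set V, (∀ i, Joins G A B (P i)) ∧ Pairwise fun i j => Disjoint (P i) (P j)

/-- No set of fewer than `k` vertices separates `A` from `B`. -/
def Unseparated (G : SimpleGraph V) (A B : Set V) (k : ℕ) : Prop :=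
  ∀ S : Finset V, S.card < k → Joins G A B (↑S : Set V)ᶜ

theorem Joins.symm {A B P : Set V} (h : Joins G A B P) : Joins G B A P := by
  obtain ⟨a, ha, b, hb, hab⟩ := h
  exact ⟨b, hb, a, ha, hab.symm⟩

theorem Unseparated.symm {A B : Set V} {k : ℕ} (h : Unseparated G A B k) :
    Unseparated G B A k := fun S hS => (h S hS).symm

theorem Linkage.mono {G' : SimpleGraph V} {A B : Set V} {ι : Type*} (h : Linkage G A B ι)
    (hG : G ≤ G') : Linkage G' A B ι := by
  obtain ⟨P, hP, hdisj⟩ := h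
  refine ⟨P, fun i => ?_, hdisj⟩
  obtain ⟨a, ha, b, hb, hab⟩ := hP i
  exact ⟨a, ha, b, hb, hab.mono hG⟩

theorem Linkage.reindex {A B : Set V} {ι κ : Type*} (h : Linkage G A B ι) (e : κ ≃ ι) :
    Linkage G A B κ := by
  obtain ⟨P, hP, hdisj⟩ := h
  exact ⟨P ∘ e, fun i => hP _, fun i j hij => hdisj (e.injective.ne hij)⟩

theorem Linkage.disjointPathsFam {A B : Set V} {ι : Type*} (h : Linkage G A B ι) :
    DisjointPathsFam G A B ι := by
  classical
  obtain ⟨P, hP, hdisj⟩ := h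
  choose a ha b hb p hp using hP
  refine ⟨a, b, fun i => (p i).bypass, fun i => (p i).bypass_isPath, ha, hb, ?_⟩
  intro i j hij x hxi hxj
  have h1 := hp i x ((p i).support_bypass_subset_support hxi)
  have h2 := hp j x ((p j).support_bypass_subset_support hxj)
  exact (Set.disjoint_left.1 (hdisj hij)) (not_not.1 h1) (not_not.1 h2)

/-- Cut a walk at the first vertex in `T`. -/
theorem exists_cut {T : Set V} {a b : V} (p : G.Walk a b) (hb : b ∈ T) :
    ∃ t ∈ T, ∃ q : G.Walk a t, q.support ⊆ p.support ∧
      ∀ v ∈ q.support, v = t ∨ ConnAvoiding G T a v := by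
  induction p with
  | nil => exact ⟨_, hb, Walk.nil, by simp, by simp⟩
  | @cons a a' b h p ih =>
    by_cases ha : a ∈ T
    · exact ⟨a, ha, Walk.nil, by simp, by simp⟩
    obtain ⟨t, ht, q, hq, hqT⟩ := ih hb
    refine ⟨t, ht, Walk.cons h q, ?_, ?_⟩
    · rw [Walk.support_cons, Walk.support_cons]
      exact List.cons_subset_cons _ hq
    · intro v hv
      rw [Walk.support_cons, List.mem_cons] at hv
      rcases hv with rfl | hv
      · exact Or.inr (connAvoiding_refl ha)
      · refine (hqT v hv).imp_right fun hav => ?_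
        exact (h.connAvoiding ha hav.left_notMem).trans hav

theorem Linkage.exists_family {A : Set V} {T : Finset V} {k : ℕ} (h : Linkage G A ↑T (Fin k))
    (hk : T.card = k) : ∃ P : V → Set V, (∀ t ∈ T, ∃ a ∈ A, ConnAvoiding G (P t)ᶜ a t) ∧
      (∀ t ∈ T, ∀ v ∈ P t, v = t ∨ v ∈ Reach G (↑T : Set V) A) ∧
      ∀ t ∈ T, ∀ t' ∈ T, t ≠ t' → Disjoint (P t) (P t') := by
  obtain ⟨P, hP, hdisj⟩ := h
  choose a ha b hb p hp using hP
  choose t ht q hq hqT using fun i => exists_cut (p i) (hb i)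
  have hqP : ∀ i, ∀ v ∈ (q i).support, v ∈ P i := fun i v hv => not_not.1 (hp i v (hq i hv))
  have hinj : Function.Injective fun i => (⟨t i, ht i⟩ : T) := by
    intro i j hij
    by_contra hne
    have htij : t i = t j := congrArg Subtype.val hij
    refine Set.disjoint_left.1 (hdisj hne) (hqP i _ (q i).end_mem_support) ?_
    rw [htij]
    exact hqP j _ (q j).end_mem_support
  have hbij : Function.Bijective fun i => (⟨t i, ht i⟩ : T) := by
    rw [Fintype.bijective_iff_injective_and_card]
    exact ⟨hinj, by simp [hk]⟩
  refine ⟨fun s => {v | ∃ i, t i = s ∧ v ∈ (q i).support}, ?_, ?_, ?_⟩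
  · intro s hs
    obtain ⟨i, hi⟩ := hbij.2 ⟨s, hs⟩
    have hi' : t i = s := congrArg Subtype.val hi
    subst hi'
    exact ⟨a i, ha i, q i, fun v hv h => h ⟨i, rfl, hv⟩⟩
  · rintro s hs v ⟨i, rfl, hv⟩
    exact (hqT i v hv).imp_right fun h => ⟨a i, ha i, h⟩
  · intro s _ s' _ hne
    rw [Set.disjoint_left]
    rintro v ⟨i, rfl, hv⟩ ⟨j, rfl, hv'⟩
    have hij : i ≠ j := fun h => hne (by rw [h])
    exact Set.disjoint_left.1 (hdisj hij) (hqP i v hv) (hqP j v hv')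

/-- `H'` arises from `H` by deleting at most the edge `xy`. -/
def DeletesEdge (H H' : SimpleGraph V) (x y : V) : Prop :=
  ∀ u v, H.Adj u v → H'.Adj u v ∨ (u = x ∧ v = y) ∨ (u = y ∧ v = x)

theorem DeletesEdge.symm {H H' : SimpleGraph V} {x y : V} (h : DeletesEdge H H' x y) :
    DeletesEdge H H' y x := fun u v huv => (h u v huv).imp_right Or.symm

theorem Unseparated.of_deletesEdge [DecidableEq V] {H H' : SimpleGraph V} {A B : Set V}
    {S : Finset V} {k : ℕ} {x y : V} (h : Unseparated H A B k) (hdel : DeletesEdge H H' x y)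
    (hsep : ∀ v ∈ B, v ∉ Reach H' (↑S : Set V) A) (hy : y ∉ Reach H' (↑S : Set V) A) :
    Unseparated H' A ↑(insert x S) k := by
  intro R hR
  obtain ⟨a, ha, b, hb, p, hp⟩ := h R hR
  have hp' : ∀ v ∈ p.support, v ∉ (↑R : Set V) := by simpa using hp
  rw [Joins, compl_compl]
  suffices hmain : ∀ {a b : V} (p : H.Walk a b), b ∈ B → (∀ v ∈ p.support, v ∉ (↑R : Set V)) →
      (a ∈ S ∨ a ∈ Reach H' (↑S : Set V) A) → ∃ t ∈ insert x S, ConnAvoiding H' (↑R : Set V) a t by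
    obtain ⟨t, ht, hat⟩ := hmain p hb hp' (by
      by_cases haS : a ∈ S
      · exact Or.inl haS
      · exact Or.inr ⟨a, ha, connAvoiding_refl haS⟩)
    exact ⟨a, ha, t, ht, hat⟩
  intro a b p
  induction p with
  | @nil a =>
    intro hb hp ha
    rcases ha with ha | ha
    · exact ⟨a, Finset.mem_insert_of_mem ha, connAvoiding_refl (hp a (by simp))⟩
    · exact absurd ha (hsep a hb)
  | @cons a a' b hadj p ih =>
    intro hb hp ha
    have haR : a ∉ (↑R : Set V) := hp a (by simp)
    have ha'R : a' ∉ (↑R : Set V) := hp a' (by simp)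
    by_cases haT : a ∈ insert x S
    · exact ⟨a, haT, connAvoiding_refl haR⟩
    have haS : a ∉ S := fun h => haT (Finset.mem_insert_of_mem h)
    have haA := ha.resolve_left haS
    have hadj' : H'.Adj a a' := by
      rcases hdel a a' hadj with h | ⟨rfl, _⟩ | ⟨rfl, _⟩
      · exact h
      · exact absurd (Finset.mem_insert_self _ _) haT
      · exact absurd haA hy
    obtain ⟨t, ht, hat⟩ := ih hb (fun v hv => hp v (by simp [hv])) (by
      by_cases ha'S : a' ∈ S
      · exact Or.inl ha'S
      · exact Or.inr (Reach.step haA hadj' ha'S))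
    exact ⟨t, ht, (hadj'.connAvoiding haR ha'R).trans hat⟩

/-- A walk either survives the deletion of the edge `xy` or splits at that edge. -/
theorem reach_of_deletesEdge {H H' : SimpleGraph V} {S B : Set V} {x y a b : V}
    (hdel : DeletesEdge H H' x y) (p : H.Walk a b) (hb : b ∈ B) (hp : ∀ v ∈ p.support, v ∉ S) :
    a ∈ Reach H' S B ∨ (ConnAvoiding H' S a x ∧ y ∈ Reach H' S B) ∨
      (ConnAvoiding H' S a y ∧ x ∈ Reach H' S B) := by
  induction p with
  | @nil a => exact Or.inl ⟨a, hb, connAvoiding_refl (hp a (by simp))⟩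
  | @cons a a' b hadj p ih =>
    have ha : a ∉ S := hp a (by simp)
    have ha' : a' ∉ S := hp a' (by simp)
    have haa := connAvoiding_refl (G := H') ha
    have ih' := ih hb fun v hv => hp v (by simp [hv])
    rcases hdel a a' hadj with h | ⟨rfl, rfl⟩ | ⟨rfl, rfl⟩
    · have hc := h.connAvoiding ha ha'
      rcases ih' with h1 | ⟨h1, h2⟩ | ⟨h1, h2⟩
      · exact Or.inl (Reach.step h1 h.symm ha)
      · exact Or.inr (Or.inl ⟨hc.trans h1, h2⟩)
      · exact Or.inr (Or.inr ⟨hc.trans h1, h2⟩)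
    · rcases ih' with h1 | ⟨h1, h2⟩ | ⟨h1, h2⟩
      · exact Or.inr (Or.inl ⟨haa, h1⟩)
      · exact Or.inr (Or.inl ⟨haa, h2⟩)
      · exact Or.inl h2
    · rcases ih' with h1 | ⟨h1, h2⟩ | ⟨h1, h2⟩
      · exact Or.inr (Or.inr ⟨haa, h1⟩)
      · exact Or.inl h2
      · exact Or.inr (Or.inr ⟨haa, h2⟩)

/-- Linkages on the two sides of a separator can be joined along the edge `xy`. -/
theorem linkage_of_split {H H' : SimpleGraph V} {A B : Set V} {S : Finset V} {k : ℕ} {x y : V}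
    (hle : H' ≤ H) (hadj : H.Adj x y) (hdel : DeletesEdge H H' x y) (h : Unseparated H A B k)
    (hS : S.card < k) (hsep : ¬ Joins H' A B (↑S : Set V)ᶜ)
    (hx : x ∈ Reach H' (↑S : Set V) A) (hy : y ∈ Reach H' (↑S : Set V) B)
    (ih : ∀ A B : Set V, Unseparated H' A B k → Linkage H' A B (Fin k)) :
    Linkage H A B (Fin k) := by
  classical
  have hdisj : ∀ v, v ∈ Reach H' (↑S : Set V) A → v ∈ Reach H' (↑S : Set V) B → False := by
    rintro v ⟨a, ha, hav⟩ ⟨b, hb, hbv⟩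
    exact hsep ⟨a, ha, b, hb, by rw [compl_compl]; exact hav.trans hbv.symm⟩
  have hRS : ∀ (A : Set V) v, v ∈ Reach H' (↑S : Set V) A → v ∉ S :=
    fun A v ⟨a, _, hav⟩ => hav.right_notMem
  have hBA : ∀ v ∈ B, v ∉ Reach H' (↑S : Set V) A := fun v hv h =>
    hdisj v h ⟨v, hv, connAvoiding_refl (hRS A v h)⟩
  have hAB : ∀ v ∈ A, v ∉ Reach H' (↑S : Set V) B := fun v hv h =>
    hdisj v ⟨v, hv, connAvoiding_refl (hRS B v h)⟩ h
  have hxS := hRS A x hx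
  have hyS := hRS B y hy
  have hcard : ∀ z, z ∉ S → z = x ∨ z = y → (insert z S).card = k := by
    intro z hzS hz
    by_contra hne
    rw [Finset.card_insert_of_notMem hzS] at hne
    obtain ⟨a, ha, b, hb, p, hp⟩ := h (insert z S)
      (by rw [Finset.card_insert_of_notMem hzS]; omega)
    rw [compl_compl] at hp
    have hp' : ∀ v ∈ p.support, v ∉ insert z S := fun v hv h => hp v hv h
    have haS : a ∉ S := fun h => hp' a p.start_mem_support (Finset.mem_insert_of_mem h)
    refine hsep ⟨a, ha, b, hb, ?_⟩
    rw [compl_compl]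
    refine ⟨p.transfer H' fun e he => ?_, fun v hv => ?_⟩
    · induction e with
      | h u v =>
        have hu := hp' u (p.fst_mem_support_of_mem_edges he)
        have hv := hp' v (p.snd_mem_support_of_mem_edges he)
        rcases hdel u v (p.adj_of_mem_edges he) with h | ⟨rfl, rfl⟩ | ⟨rfl, rfl⟩
        · exact h
        · exact (hz.elim (fun h => hu (h ▸ Finset.mem_insert_self _ _))
            fun h => hv (h ▸ Finset.mem_insert_self _ _)).elim
        · exact (hz.elim (fun h => hv (h ▸ Finset.mem_insert_self _ _))
            fun h => hu (h ▸ Finset.mem_insert_self _ _)).elim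
    · rw [Walk.support_transfer] at hv
      exact fun h => hp' v hv (Finset.mem_insert_of_mem h)
  obtain ⟨P, hP, hPR, hPd⟩ := (ih _ _ (h.of_deletesEdge hdel hBA
    fun h => hdisj y h hy)).exists_family (hcard x hxS (Or.inl rfl))
  obtain ⟨Q, hQ, hQR, hQd⟩ := (ih _ _ (h.symm.of_deletesEdge hdel.symm hAB
    fun h => hdisj x hx h)).exists_family (hcard y hyS (Or.inr rfl))
  have hPR' : ∀ t ∈ insert x S, ∀ v ∈ P t, v ∈ Reach H' (↑S : Set V) A ∨ (v = t ∧ t ∈ S) := by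
    intro t ht v hv
    rcases hPR t ht v hv with rfl | ⟨a, ha, hav⟩
    · rcases Finset.mem_insert.1 ht with rfl | h
      · exact Or.inl hx
      · exact Or.inr ⟨rfl, h⟩
    · exact Or.inl ⟨a, ha, hav.anti (by simp)⟩
  have hQR' : ∀ t ∈ insert y S, ∀ v ∈ Q t, v ∈ Reach H' (↑S : Set V) B ∨ (v = t ∧ t ∈ S) := by
    intro t ht v hv
    rcases hQR t ht v hv with rfl | ⟨a, ha, hav⟩
    · rcases Finset.mem_insert.1 ht with rfl | h
      · exact Or.inl hy
      · exact Or.inr ⟨rfl, h⟩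
    · exact Or.inl ⟨a, ha, hav.anti (by simp)⟩
  set σ : V → V := fun t => if t = x then y else t with hσ
  have hσx : σ x = y := if_pos rfl
  have hσS : ∀ t ∈ S, σ t = t := fun t ht => if_neg (by rintro rfl; exact hxS ht)
  have hσmem : ∀ t ∈ insert x S, σ t ∈ insert y S := by
    intro t ht
    rcases Finset.mem_insert.1 ht with rfl | h
    · rw [hσx]; exact Finset.mem_insert_self _ _
    · rw [hσS t h]; exact Finset.mem_insert_of_mem h
  have hσS' : ∀ t ∈ insert x S, σ t ∈ S → t ∈ S := by
    intro t ht h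
    rcases Finset.mem_insert.1 ht with rfl | h'
    · rw [hσx] at h; exact absurd h hyS
    · exact h'
  have hσinj : ∀ t ∈ insert x S, ∀ t' ∈ insert x S, σ t = σ t' → t = t' := by
    intro t ht t' ht' h
    rcases Finset.mem_insert.1 ht with rfl | h1 <;> rcases Finset.mem_insert.1 ht' with rfl | h2
    · rfl
    · rw [hσx, hσS _ h2] at h; exact absurd (h ▸ h2) hyS
    · rw [hσx, hσS _ h1] at h; exact absurd (h ▸ h1) hyS
    · rwa [hσS _ h1, hσS _ h2] at h
  have hPQ : ∀ t ∈ insert x S, ∀ t' ∈ insert x S, t ≠ t' → Disjoint (P t) (Q (σ t')) := by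
    intro t ht t' ht' hne
    rw [Set.disjoint_left]
    intro v hv hv'
    rcases hPR' t ht v hv with h1 | ⟨rfl, h1⟩ <;>
      rcases hQR' _ (hσmem t' ht') v hv' with h2 | ⟨h2, h2'⟩
    · exact hdisj v h1 h2
    · exact hRS A v h1 (h2 ▸ h2')
    · exact hRS B _ h2 h1
    · rw [hσS t' (hσS' t' ht' h2')] at h2
      exact hne h2
  have hL : Linkage H A B (↥(insert x S)) := by
    refine ⟨fun t => P t ∪ Q (σ t), ?_, ?_⟩
    · rintro ⟨t, ht⟩
      obtain ⟨a, ha, hat⟩ := hP t ht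
      obtain ⟨b, hb, hbt⟩ := hQ (σ t) (hσmem t ht)
      have h1 : ConnAvoiding H (P t ∪ Q (σ t))ᶜ a t :=
        (hat.mono hle).anti (Set.compl_subset_compl.2 Set.subset_union_left)
      have h2 : ConnAvoiding H (P t ∪ Q (σ t))ᶜ b (σ t) :=
        (hbt.mono hle).anti (Set.compl_subset_compl.2 Set.subset_union_right)
      refine ⟨a, ha, b, hb, ?_⟩
      show ConnAvoiding H (P t ∪ Q (σ t))ᶜ a b
      rcases Finset.mem_insert.1 ht with rfl | h
      · rw [hσx] at h2 ⊢
        rw [hσx] at h1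
        exact (h1.trans (hadj.connAvoiding h1.right_notMem h2.right_notMem)).trans h2.symm
      · rw [hσS t h] at h1 h2 ⊢
        exact h1.trans h2.symm
    · rintro ⟨t, ht⟩ ⟨t', ht'⟩ hne
      have hne' : t ≠ t' := fun h => hne (Subtype.ext h)
      have hσne : σ t ≠ σ t' := fun h => hne' (hσinj t ht t' ht' h)
      simp only [Set.disjoint_union_left, Set.disjoint_union_right]
      exact ⟨⟨hPd t ht t' ht' hne', (hPQ t' ht' t ht hne'.symm).symm⟩, hPQ t ht t' ht' hne',
        hQd _ (hσmem t ht) _ (hσmem t' ht') hσne⟩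
  exact hL.reindex (Fintype.equivFinOfCardEq (by simp [hcard x hxS (Or.inl rfl)])).symm

theorem linkage_of_finite_edgeSet {H : SimpleGraph V} (hfin : H.edgeSet.Finite) {k : ℕ}
    {A B : Set V} (h : Unseparated H A B k) : Linkage H A B (Fin k) := by
  induction hn : H.edgeSet.ncard using Nat.strong_induction_on generalizing H A B with
  | _ n ih =>
  by_cases hE : ∃ x y, H.Adj x y
  · obtain ⟨x, y, hxy⟩ := hE
    set H' := H.deleteEdges {s(x, y)} with hH'
    have hle : H' ≤ H := deleteEdges_le _
    have hlt : H'.edgeSet ⊂ H.edgeSet := by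
      rw [hH', edgeSet_deleteEdges]
      exact ⟨Set.sdiff_subset, fun hsub => (hsub (show s(x, y) ∈ H.edgeSet from hxy)).2 rfl⟩
    have hdel : DeletesEdge H H' x y := by
      intro u v huv
      by_cases he : s(u, v) = s(x, y)
      · exact Or.inr (by simpa using he)
      · exact Or.inl (by rw [hH', deleteEdges_adj]; exact ⟨huv, he⟩)
    have ih' : ∀ A B : Set V, Unseparated H' A B k → Linkage H' A B (Fin k) := fun A B hAB =>
      ih _ (hn ▸ Set.ncard_lt_ncard hlt hfin) (hfin.subset hlt.subset) hAB rfl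
    by_cases hu : Unseparated H' A B k
    · exact (ih' A B hu).mono hle
    · unfold Unseparated at hu
      push Not at hu
      obtain ⟨S, hS, hsep⟩ := hu
      obtain ⟨a, ha, b, hb, p, hp⟩ := h S hS
      rw [compl_compl] at hp
      have haS := hp a p.start_mem_support
      rcases reach_of_deletesEdge hdel p hb hp with ⟨b', hb', hba⟩ | ⟨h1, h2⟩ | ⟨h1, h2⟩
      · exact absurd ⟨a, ha, b', hb', by rw [compl_compl]; exact hba.symm⟩ hsep
      · exact linkage_of_split hle hxy hdel h hS hsep ⟨a, ha, h1⟩ h2 ih'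
      · exact linkage_of_split hle hxy.symm hdel.symm h hS hsep ⟨a, ha, h1⟩ h2 ih'
  · push Not at hE
    have hk : (k : ℕ∞) ≤ (A ∩ B).encard := by
      by_contra! hlt
      have hfinAB : (A ∩ B).Finite := Set.encard_ne_top_iff.1 hlt.ne_top
      obtain ⟨a, ha, b, hb, p, hp⟩ := h hfinAB.toFinset (by
        rw [hfinAB.encard_eq_coe_toFinset_card] at hlt
        exact_mod_cast hlt)
      cases p with
      | nil => exact hp a (by simp) (by simp [ha, hb])
      | cons hadj _ => exact hE _ _ hadj
    obtain ⟨T, hT, hTk⟩ := Set.exists_subset_encard_eq hk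
    have hTfin : T.Finite := Set.encard_ne_top_iff.1 (by simp [hTk])
    have hcard : hTfin.toFinset.card = k := by
      rw [hTfin.encard_eq_coe_toFinset_card] at hTk
      exact_mod_cast hTk
    have hL : Linkage H A B hTfin.toFinset := by
      refine ⟨fun t => {t.1}, ?_, ?_⟩
      · rintro ⟨t, ht⟩
        have := hT (hTfin.mem_toFinset.1 ht)
        exact ⟨t, this.1, t, this.2, connAvoiding_refl (by simp)⟩
      · rintro ⟨t, ht⟩ ⟨t', ht'⟩ hne
        simpa using fun h => hne (Subtype.ext h)
    exact hL.reindex (Fintype.equivFinOfCardEq (by simp [hcard])).symm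

/-- Menger's theorem for finitely many paths in an arbitrary graph. -/
theorem Unseparated.linkage {k : ℕ} {A B : Set V} (h : Unseparated G A B k) :
    Linkage G A B (Fin k) := by
  classical
  let H : Finset (Sym2 V) → SimpleGraph V := fun F =>
    G ⊓ SimpleGraph.fromEdgeSet (↑F : Set (Sym2 V))
  have hle : ∀ F, H F ≤ G := fun F => inf_le_left
  by_contra hcon
  have hsep : ∀ F, ∃ S : Finset V, S.card < k ∧ ¬ Joins (H F) A B (↑S : Set V)ᶜ := by
    intro F
    by_contra! hF
    refine hcon ((linkage_of_finite_edgeSet (H := H F) ?_ hF).mono (hle F))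
    refine F.finite_toSet.subset ?_
    intro e he
    induction e with
    | h u v =>
      have : (H F).Adj u v := he
      simp only [H, inf_adj, fromEdgeSet_adj] at this
      exact this.2.1
  choose S hSk hS using hsep
  let ω : Ultrafilter (Finset (Sym2 V)) := Ultrafilter.of Filter.atTop
  have hω : ∀ s ∈ (Filter.atTop : Filter (Finset (Sym2 V))), s ∈ ω := fun s hs =>
    Ultrafilter.of_le _ hs
  set L : Set V := {v | {F | v ∈ S F} ∈ ω} with hL
  have hsub : ∀ T : Finset V, (∀ v ∈ T, v ∈ L) → T.card < k := by
    intro T hT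
    have : (⋂ v ∈ T, {F | v ∈ S F}) ∈ ω := (Filter.biInter_finset_mem T).2 hT
    obtain ⟨F, hF⟩ := ω.nonempty_of_mem this
    exact (Finset.card_le_card fun v hv => Set.mem_iInter₂.1 hF v hv).trans_lt (hSk F)
  have hLfin : L.Finite := by
    by_contra hinf
    obtain ⟨T, hT, hTk⟩ := Set.Infinite.exists_subset_card_eq hinf k
    exact absurd (hsub T fun v hv => hT hv) (by omega)
  obtain ⟨a, ha, b, hb, p, hp⟩ := h hLfin.toFinset (hsub _ (by simp))
  rw [compl_compl] at hp
  have hp' : ∀ v ∈ p.support, {F | v ∉ S F} ∈ ω := by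
    intro v hv
    have : v ∉ L := by simpa using hp v hv
    exact Ultrafilter.compl_mem_iff_notMem.2 this
  have h1 : (⋂ v ∈ p.support.toFinset, {F | v ∉ S F}) ∈ ω :=
    (Filter.biInter_finset_mem _).2 fun v hv => hp' v (by simpa using hv)
  obtain ⟨F, hF, hpF⟩ := ω.nonempty_of_mem
    (Filter.inter_mem h1 (hω _ (Filter.mem_atTop p.edges.toFinset)))
  refine hS F ⟨a, ha, b, hb, p.transfer (H F) ?_, ?_⟩
  · intro e he
    have heF : e ∈ F := hpF (by simpa using he)
    induction e with
    | h u v =>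
      have hadj := p.adj_of_mem_edges he
      simp only [H, mem_edgeSet, inf_adj, fromEdgeSet_adj]
      exact ⟨hadj, heF, hadj.ne⟩
  · intro v hv
    rw [Walk.support_transfer] at hv
    rw [compl_compl]
    exact Set.mem_iInter₂.1 hF v (by simpa using hv)

/-- In a tree, the nodes beyond `t` are closed under steps that do not go below `t`. -/
theorem mem_beyond_of_walk {M : Type v} {T : SimpleGraph M} (hT : T.IsTree) {r t s s' : M}
    (hs : ∃ p : T.Walk r s, p.IsPath ∧ t ∈ p.support) (w : T.Walk s s')
    (hw : ∀ x ∈ w.support, T.dist r t ≤ T.dist r x) :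
    ∃ p : T.Walk r s', p.IsPath ∧ t ∈ p.support := by
  classical
  induction w with
  | nil => exact hs
  | @cons a b c hab w ih =>
    refine ih ?_ fun x hx => hw x (by simp [hx])
    obtain ⟨p, hp, ht⟩ := hs
    by_cases hb : b ∈ p.support
    · have hq := hp.takeUntil hb
      have hpq := hT.isAcyclic.path_concat hq hp hab.symm hb
      refine ⟨p.takeUntil b hb, hq, ?_⟩
      rw [hpq, Walk.support_concat, List.mem_append] at ht
      refine ht.resolve_right fun h => ?_
      obtain rfl : t = a := by simpa using h
      obtain ⟨q, hq', hql⟩ := (hT.connected r t).exists_path_of_dist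
      have hqp : q = p := (hT.existsUnique_path r t).unique hq' hp
      have h1 := hw b (by simp)
      have h2 := dist_le (p.takeUntil b hb)
      have h3 := congrArg Walk.length hpq
      rw [Walk.length_concat] at h3
      rw [hqp] at hql
      omega
    · refine ⟨p.concat hab, hp.concat hb hab, ?_⟩
      rw [Walk.support_concat]
      exact List.mem_append_left _ ht

/-- The vertices of least height in a connected set share a bag, where the height of a vertex is
the least distance from the root to a bag containing it. -/
theorem exists_height {M : Type v} {T : SimpleGraph M} (D : TreeDecomp G T) (hD : D.FiniteParts) :
    ∃ h : V → ℕ, ∀ C : Set V, (G.induce C).Connected → {x ∈ C | ∀ y ∈ C, h x ≤ h y}.Finite := by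
  classical
  obtain ⟨r⟩ := D.isTree.connected.nonempty
  have key : ∀ x : V, ∃ t, x ∈ D.bag t ∧ ∀ s, x ∈ D.bag s → T.dist r t ≤ T.dist r s := by
    intro x
    obtain ⟨t, ht, hmin⟩ := (InvImage.wf (T.dist r) Nat.lt_wfRel.wf).has_min {t | x ∈ D.bag t}
      (D.bag_cover x)
    exact ⟨t, ht, fun s hs => not_lt.1 (hmin s hs)⟩
  choose τ hτ hτmin using key
  refine ⟨fun x => T.dist r (τ x), fun C hC => ?_⟩
  rcases Set.eq_empty_or_nonempty {x ∈ C | ∀ y ∈ C, T.dist r (τ x) ≤ T.dist r (τ y)} with h | h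
  · rw [h]; exact Set.finite_empty
  obtain ⟨x, hxC, hx⟩ := h
  refine (hD (τ x)).subset ?_
  rintro y ⟨hyC, hy⟩
  set W : Set M := {s | ∃ p : T.Walk r s, p.IsPath ∧ τ x ∈ p.support} with hW
  have hbags : ∀ z ∈ C, ∀ s ∈ W, z ∈ D.bag s → ∀ t, z ∈ D.bag t → t ∈ W := by
    intro z hz s hs hzs t hzt
    obtain ⟨p, hp, -⟩ := D.isTree.existsUnique_path s t
    exact mem_beyond_of_walk D.isTree hs p fun a ha =>
      (hx z hz).trans (hτmin z a (D.bag_conn z p hp hzs hzt a ha))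
  have hxW : τ x ∈ W := by
    obtain ⟨p, hp, -⟩ := D.isTree.existsUnique_path r (τ x)
    exact ⟨p, hp, p.end_mem_support⟩
  have hsub : C ⊆ {z | ∃ s ∈ W, z ∈ D.bag s} := by
    refine subset_of_connected_of_closed hC ⟨x, hxC, τ x, hxW, hτ x⟩ ?_
    rintro a ha ⟨s, hs, has⟩ b hb hab
    obtain ⟨t, hat, hbt⟩ := D.bag_edge hab
    exact ⟨t, hbags a ha s hs has t hat, hbt⟩
  obtain ⟨s, hs, hys⟩ := hsub hyC
  obtain ⟨p, hp, hpx⟩ := hbags y hyC s hs hys (τ y) (hτ y)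
  obtain ⟨q, hq, hql⟩ := (D.isTree.connected r (τ y)).exists_path_of_dist
  obtain rfl : q = p := (D.isTree.existsUnique_path r (τ y)).unique hq hp
  have h1 := congrArg Walk.length (q.take_spec hpx)
  rw [Walk.length_append] at h1
  have h2 := dist_le (q.takeUntil _ hpx)
  have h3 : T.dist r (τ y) ≤ T.dist r (τ x) := hy x hxC
  have h4 : (q.dropUntil _ hpx).length = 0 := by omega
  rw [Walk.eq_of_length_eq_zero h4]
  exact hτ y

/-- The sets obtained by repeatedly passing to a component and deleting its part `F C`. -/
inductive Piece (G : SimpleGraph V) (F : Set V → Set V) : Set V → Prop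
  | base {C : Set V} : IsCompOf G Set.univ C → Piece G F C
  | step {C E : Set V} : Piece G F C → IsCompOf G (C \ F C) E → Piece G F E

theorem Piece.connected {F : Set V → Set V} {C : Set V} (h : Piece G F C) :
    (G.induce C).Connected := by
  cases h with
  | base h => exact h.2.2.1
  | step _ h => exact h.2.2.1

/-- `F C` is a finite part of `C` as needed to refine a decomposition. -/
structure IsPart (G : SimpleGraph V) (C F : Set V) : Prop where
  subset : F ⊆ C
  finite : F.Finite
  nonempty : F.Nonempty
  pushes : Pushes G C F
  robust : ∀ E, IsCompOf G (C \ F) E → Robust G C E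

theorem nbhd_component_eq_empty {C : Set V} (h : IsCompOf G Set.univ C) : NbhdSet G C = ∅ := by
  rw [Set.eq_empty_iff_forall_notMem]
  rintro v ⟨hv, u, hu, huv⟩
  exact hv (h.closedIn u hu v trivial huv)

theorem Piece.ord_ne_top {F : Set V → Set V}
    (hF : ∀ C, (G.induce C).Connected → ord G C ≠ ⊤ → (F C).Finite) {C : Set V}
    (h : Piece G F C) : ord G C ≠ ⊤ := by
  induction h with
  | base h => simp [ord, nbhd_component_eq_empty h]
  | step h hE ih => exact ord_comp_ne_top ih (hF _ h.connected ih) hE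

/-- A choice of parts that exhausts every piece. -/
theorem exists_partition_function {h : V → ℕ}
    (hh : ∀ C : Set V, (G.induce C).Connected → {x ∈ C | ∀ y ∈ C, h x ≤ h y}.Finite) :
    ∃ F : Set V → Set V, (∀ C, Piece G F C → IsPart G C (F C) ∧ ord G C ≠ ⊤) ∧
      ∀ C v, Piece G F C → v ∈ C → ∃ E, Piece G F E ∧ v ∈ F E := by
  have hmin : ∀ C : Set V, C.Nonempty → ∃ u ∈ C, ∀ y ∈ C, h u ≤ h y := by
    intro C hC
    obtain ⟨t, ht, hmin⟩ := (InvImage.wf h Nat.lt_wfRel.wf).has_min C hC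
    exact ⟨t, ht, fun s hs => not_lt.1 (hmin s hs)⟩
  have hex : ∀ C : Set V, ∃ F : Set V, (G.induce C).Connected → ord G C ≠ ⊤ → IsPart G C F ∧
      ∃ u ∈ C, (∀ y ∈ C, h u ≤ h y) ∧ ∀ E, IsCompOf G (C \ F) E → u ∈ E → ord G E < ord G C := by
    intro C
    by_cases hC : (G.induce C).Connected ∧ ord G C ≠ ⊤
    · obtain ⟨u, hu, humin⟩ := hmin C (Set.nonempty_coe_sort.1 hC.1.nonempty)
      obtain ⟨F, h1, h2, h3, h4, h5⟩ := exists_part hC.1 hC.2 hu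
      exact ⟨F, fun _ _ => ⟨⟨h1, h2, h3, h4, fun E hE => (h5 E hE).1⟩, u, hu, humin,
        fun E hE => (h5 E hE).2⟩⟩
    · exact ⟨∅, fun h1 h2 => absurd ⟨h1, h2⟩ hC⟩
  choose F hF using hex
  have hord : ∀ C, Piece G F C → ord G C ≠ ⊤ := fun C hC =>
    hC.ord_ne_top fun C h1 h2 => (hF C h1 h2).1.finite
  refine ⟨F, fun C hC => ⟨(hF C hC.connected (hord C hC)).1, hord C hC⟩, ?_⟩
  intro C v hC hv
  set U : Set V → Set V := fun C => {x ∈ C | ∀ y ∈ C, h x ≤ h y} with hU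
  set μ : Set V → ℕ ×ₗ ℕ ×ₗ ℕ := fun C =>
    toLex (h v - sInf (h '' C), toLex ((U C).ncard, (ord G C).toNat)) with hμ
  induction hx : μ C using WellFoundedLT.induction generalizing C with
  | ind x ih =>
  subst hx
  by_cases hvF : v ∈ F C
  · exact ⟨C, hC, hvF⟩
  obtain ⟨E, hE, hvE⟩ := exists_isCompOf (G := G) (S := C \ F C) ⟨hv, hvF⟩
  have hEP := Piece.step hC hE
  refine ih (μ E) ?_ E hEP hvE rfl
  have hEC : E ⊆ C := hE.2.1.trans Set.sdiff_subset
  obtain ⟨u, hu, humin, hud⟩ := (hF C hC.connected (hord C hC)).2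
  have hsInf : ∀ (C : Set V) u, u ∈ C → (∀ y ∈ C, h u ≤ h y) → sInf (h '' C) = h u :=
    fun C u hu hmin => le_antisymm (Nat.sInf_le ⟨u, hu, rfl⟩)
      (le_csInf ⟨_, u, hu, rfl⟩ (by rintro _ ⟨y, hy, rfl⟩; exact hmin y hy))
  obtain ⟨w, hw, hwmin⟩ := hmin E ⟨v, hvE⟩
  have hC' := hsInf C u hu humin
  have hE' := hsInf E w hw hwmin
  have h1 : h u ≤ h w := humin w (hEC hw)
  have h2 : h w ≤ h v := hwmin v hvE
  simp only [hμ, Prod.Lex.toLex_lt_toLex, hC', hE']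
  rcases h1.lt_or_eq with h3 | h3
  · exact Or.inl (by omega)
  refine Or.inr ⟨by rw [h3], ?_⟩
  have hUsub : U E ⊆ U C := fun z hz => ⟨hEC hz.1, fun y hy =>
    ((hz.2 w hw).trans h3.ge).trans (humin y hy)⟩
  have hUfin : (U C).Finite := hh C hC.connected
  by_cases huE : u ∈ E
  · rcases (Set.ncard_le_ncard hUsub hUfin).lt_or_eq with h4 | h4
    · exact Or.inl h4
    · refine Or.inr ⟨h4, ?_⟩
      rw [← ENat.natCast_lt_natCast, ENat.natCast_toNat (hord E hEP),
        ENat.natCast_toNat (hord C hC)]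
      exact hud E hE huE
  · exact Or.inl (Set.ncard_lt_ncard ⟨hUsub, fun h => huE (h ⟨hu, humin⟩).1⟩ hUfin)

/-- The tree of all lists satisfying `P`, each list being joined to its tail. -/
def listTree {α : Type*} (P : List α → Prop) : SimpleGraph {l // P l} where
  Adj x y := (∃ a, x.1 = a :: y.1) ∨ ∃ a, y.1 = a :: x.1
  symm := ⟨fun _ _ h => h.symm⟩
  loopless := ⟨by rintro ⟨x, hx⟩ (⟨a, h⟩ | ⟨a, h⟩) <;> simpa using congrArg List.length h⟩

section listTree

variable {α : Type*} {P : List α → Prop}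

theorem exists_walk_down (hP : ∀ a l, P (a :: l) → P l) {x y : {l // P l}} (h : y.1 <:+ x.1) :
    ∃ w : (listTree P).Walk x y, ∀ z ∈ w.support, y.1 <:+ z.1 ∧ z.1 <:+ x.1 := by
  obtain ⟨x, hx⟩ := x
  obtain ⟨y, hy⟩ := y
  induction x with
  | nil =>
    obtain rfl : y = [] := List.suffix_nil.1 h
    exact ⟨Walk.nil, by simp⟩
  | cons a l ih =>
    rcases List.suffix_cons_iff.1 h with rfl | h
    · exact ⟨Walk.nil, by simp⟩
    · obtain ⟨w, hw⟩ := ih (hP a l hx) h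
      refine ⟨Walk.cons (v := ⟨l, hP a l hx⟩) (Or.inl ⟨a, rfl⟩) w, fun z hz => ?_⟩
      rcases List.mem_cons.1 hz with rfl | hz
      · exact ⟨h.trans (List.suffix_cons a l), List.suffix_rfl⟩
      · exact ⟨(hw z hz).1, (hw z hz).2.trans (List.suffix_cons a l)⟩

theorem mem_edges_of_suffix {x y m l : {l // P l}} {a : α} (hm : m.1 = a :: l.1)
    (w : (listTree P).Walk x y) (hx : ¬ m.1 <:+ x.1) (hy : m.1 <:+ y.1) :
    s(l, m) ∈ w.edges := by
  induction w with
  | nil => exact absurd hy hx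
  | @cons x x' y h w ih =>
    rw [Walk.edges_cons, List.mem_cons]
    by_cases hx' : m.1 <:+ x'.1
    · left
      rcases h with ⟨b, h⟩ | ⟨b, h⟩
      · exact absurd (h ▸ hx'.trans (List.suffix_cons b x'.1)) hx
      · rw [h, List.suffix_cons_iff] at hx'
        have hmx := hx'.resolve_right hx
        obtain rfl : m = x' := Subtype.ext (hmx.trans h.symm)
        obtain rfl : l = x := Subtype.ext (List.cons.inj (hm.symm.trans hmx)).2
        rfl
    · exact Or.inr (ih hx' hy)

theorem listTree_isTree (h0 : P []) (hP : ∀ a l, P (a :: l) → P l) : (listTree P).IsTree := by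
  have hreach : ∀ x, (listTree P).Reachable x ⟨[], h0⟩ := fun x =>
    ⟨(exists_walk_down hP (List.nil_suffix (l := x.1))).choose⟩
  have : Nonempty {l // P l} := ⟨⟨[], h0⟩⟩
  refine ⟨⟨fun x y => (hreach x).trans (hreach y).symm⟩, ?_⟩
  have key : ∀ x y : {l // P l}, ∀ a, y.1 = a :: x.1 → (listTree P).IsBridge s(x, y) := by
    intro x y a h
    rw [isBridge_iff]
    rintro ⟨w⟩
    have hmem := mem_edges_of_suffix h (w.mapLe (deleteEdges_le _)) (fun hs => by
      have := hs.length_le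
      rw [h] at this
      simp at this) List.suffix_rfl
    rw [Walk.edges_mapLe_eq_edges] at hmem
    have := w.adj_of_mem_edges hmem
    simp at this
  rw [isAcyclic_iff_forall_adj_isBridge]
  rintro x y (⟨a, h⟩ | ⟨a, h⟩)
  · rw [Sym2.eq_swap]
    exact key y x a h
  · exact key x y a h

/-- A path from `x` to `y` stays among the lists between `m` and one of its ends, for any common
suffix `m`. -/
theorem suffix_of_mem_path (h0 : P []) (hP : ∀ a l, P (a :: l) → P l) {x y m : {l // P l}}
    (hx : m.1 <:+ x.1) (hy : m.1 <:+ y.1) {p : (listTree P).Walk x y} (hp : p.IsPath)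
    {z : {l // P l}} (hz : z ∈ p.support) : m.1 <:+ z.1 ∧ (z.1 <:+ x.1 ∨ z.1 <:+ y.1) := by
  classical
  obtain ⟨w, hw⟩ := exists_walk_down hP hx
  obtain ⟨w', hw'⟩ := exists_walk_down hP hy
  have heq : p = (w.append w'.reverse).bypass :=
    ((listTree_isTree h0 hP).existsUnique_path x y).unique hp (Walk.bypass_isPath _)
  rw [heq] at hz
  have hz' := Walk.support_bypass_subset_support _ hz
  rw [Walk.mem_support_append_iff, Walk.support_reverse, List.mem_reverse] at hz'
  rcases hz' with h | h
  · exact ⟨(hw z h).1, Or.inl (hw z h).2⟩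
  · exact ⟨(hw' z h).1, Or.inr (hw' z h).2⟩

theorem mem_path_of_suffix (hP : ∀ a l, P (a :: l) → P l) {x y m : {l // P l}}
    (p : (listTree P).Walk x y) (hx : x.1 <:+ m.1) (hy : m.1 <:+ y.1) : m ∈ p.support := by
  by_cases h : m.1 <:+ x.1
  · obtain rfl : m = x := Subtype.ext (h.eq_of_length_le hx.length_le)
    exact p.start_mem_support
  · obtain ⟨_ | ⟨a, l⟩, hm⟩ := m
    · exact absurd List.nil_suffix h
    · exact p.snd_mem_support_of_mem_edges
        (mem_edges_of_suffix (l := ⟨l, hP a l hm⟩) rfl p h hy)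

end listTree

variable {F : Set V → Set V}

/-- The innermost piece of a branch. -/
def top : List (Set V) → Set V
  | [] => Set.univ
  | C :: _ => C

/-- The part of the innermost piece of a branch. -/
def part (F : Set V → Set V) : List (Set V) → Set V
  | [] => ∅
  | C :: _ => F C

/-- The bag of a branch. -/
def branchBag (G : SimpleGraph V) (F : Set V → Set V) (l : List (Set V)) : Set V :=
  NbhdSet G (top l) ∪ part F l

/-- Nested sequences of pieces, listed from the innermost one outwards. -/
inductive Branch (G : SimpleGraph V) (F : Set V → Set V) : List (Set V) → Prop
  | nil : Branch G F []
  | cons {C : Set V} {l : List (Set V)} :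
      Branch G F l → IsCompOf G (top l \ part F l) C → Branch G F (C :: l)

theorem Branch.tail {C : Set V} {l : List (Set V)} (h : Branch G F (C :: l)) : Branch G F l := by
  cases h with
  | cons h _ => exact h

theorem Branch.isCompOf {C : Set V} {l : List (Set V)} (h : Branch G F (C :: l)) :
    IsCompOf G (top l \ part F l) C := by
  cases h with
  | cons _ h => exact h

theorem Branch.of_suffix {l m : List (Set V)} (h : Branch G F m) (hl : l <:+ m) :
    Branch G F l := by
  induction m with
  | nil => exact List.suffix_nil.1 hl ▸ h
  | cons C m ih =>
    rcases List.suffix_cons_iff.1 hl with rfl | hl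
    · exact h
    · exact ih h.tail hl

theorem Branch.piece {C : Set V} {l : List (Set V)} (h : Branch G F (C :: l)) : Piece G F C := by
  induction l generalizing C with
  | nil => exact Piece.base (by simpa [top, part] using h.isCompOf)
  | cons D l ih => exact Piece.step (ih h.tail) h.isCompOf

theorem Piece.exists_branch {C : Set V} (h : Piece G F C) : ∃ l, Branch G F (C :: l) := by
  induction h with
  | base h => exact ⟨[], Branch.nil.cons (by simpa [top, part] using h)⟩
  | step _ h ih =>
    obtain ⟨l, hl⟩ := ih
    exact ⟨_, hl.cons h⟩

theorem Branch.top_subset {l m : List (Set V)} (h : Branch G F m) (hl : l <:+ m) :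
    top m ⊆ top l := by
  induction m with
  | nil => exact List.suffix_nil.1 hl ▸ subset_rfl
  | cons C m ih =>
    rcases List.suffix_cons_iff.1 hl with rfl | hl
    · exact subset_rfl
    · exact (h.isCompOf.2.1.trans Set.sdiff_subset).trans (ih h.tail hl)

theorem Branch.top_subset_diff {l m : List (Set V)} (h : Branch G F m) (hl : l <:+ m)
    (hne : l ≠ m) : top m ⊆ top l \ part F l := by
  cases m with
  | nil => exact absurd (List.suffix_nil.1 hl) hne
  | cons C m =>
    have hl' := (List.suffix_cons_iff.1 hl).resolve_left hne
    by_cases heq : l = m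
    · exact heq ▸ h.isCompOf.2.1
    · exact h.isCompOf.2.1.trans (Set.sdiff_subset.trans (h.tail.top_subset_diff hl' heq))

/-- Branches with intersecting innermost pieces are comparable. -/
theorem Branch.comparable {l m : List (Set V)} {v : V} (hl : Branch G F l) (hm : Branch G F m)
    (hvl : v ∈ top l) (hvm : v ∈ top m) : l <:+ m ∨ m <:+ l := by
  induction l with
  | nil => exact Or.inl List.nil_suffix
  | cons C l ih =>
    rcases ih hl.tail (hl.top_subset (List.suffix_cons C l) hvl) with h | h
    · obtain ⟨k, rfl⟩ := h
      rcases k.eq_nil_or_concat with rfl | ⟨k, D, rfl⟩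
      · exact Or.inr (List.suffix_cons C l)
      · have hsuf : D :: l <:+ k.concat D ++ l := ⟨k, by simp⟩
        have hD := hm.of_suffix hsuf
        have := hl.isCompOf.eq_of_meets hD.isCompOf ⟨v, hvl, hm.top_subset hsuf hvm⟩
        exact Or.inl (this ▸ hsuf)
    · exact Or.inr (h.trans (List.suffix_cons C l))

/-- Every piece has a part, and the parts exhaust the pieces. -/
structure Exhausts (G : SimpleGraph V) (F : Set V → Set V) : Prop where
  isPart : ∀ C, Piece G F C → IsPart G C (F C)
  ord_ne_top : ∀ C, Piece G F C → ord G C ≠ ⊤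
  exists_part : ∀ C v, Piece G F C → v ∈ C → ∃ E, Piece G F E ∧ v ∈ F E

namespace Exhausts

theorem part_subset (hF : Exhausts G F) {l : List (Set V)} (h : Branch G F l) :
    part F l ⊆ top l := by
  cases l with
  | nil => exact Set.empty_subset _
  | cons C l => exact (hF.isPart C h.piece).subset

theorem exists_home (hF : Exhausts G F) (v : V) : ∃ l, Branch G F l ∧ v ∈ part F l := by
  obtain ⟨C, hC, hv⟩ := exists_isCompOf (G := G) (S := Set.univ) (x := v) trivial
  obtain ⟨E, hE, hvE⟩ := hF.exists_part C v (Piece.base hC) hv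
  obtain ⟨l, hl⟩ := hE.exists_branch
  exact ⟨_, hl, hvE⟩

theorem suffix_home (hF : Exhausts G F) {l m : List (Set V)} {v : V} (hl : Branch G F l)
    (hm : Branch G F m) (hvl : v ∈ part F l) (hvm : v ∈ top m) : m <:+ l := by
  rcases hl.comparable hm (hF.part_subset hl hvl) hvm with h | h
  · by_cases heq : l = m
    · exact heq ▸ List.suffix_rfl
    · exact absurd hvl (hm.top_subset_diff h heq hvm).2
  · exact h

theorem home_unique (hF : Exhausts G F) {l m : List (Set V)} {v : V} (hl : Branch G F l)
    (hm : Branch G F m) (hvl : v ∈ part F l) (hvm : v ∈ part F m) : l = m := by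
  have h1 := hF.suffix_home hl hm hvl (hF.part_subset hm hvm)
  have h2 := hF.suffix_home hm hl hvm (hF.part_subset hl hvl)
  exact h2.eq_of_length_le h1.length_le

/-- Every bag containing `v` lies above the home of `v`, and so do all bags in between. -/
theorem mem_bag_between (hF : Exhausts G F) {l τ : List (Set V)} {v : V} (hτ : Branch G F τ)
    (hvτ : v ∈ part F τ) (hl : Branch G F l) (hvl : v ∈ branchBag G F l) :
    τ <:+ l ∧ ∀ m, τ <:+ m → m <:+ l → v ∈ branchBag G F m := by
  by_cases hv : v ∈ part F l
  · obtain rfl := hF.home_unique hτ hl hvτ hv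
    refine ⟨List.suffix_rfl, fun m h1 h2 => ?_⟩
    rwa [h2.eq_of_length_le h1.length_le]
  have hN := hvl.resolve_right hv
  induction l with
  | nil => exact absurd trivial hN.1
  | cons C l ih =>
    have hb : v ∈ branchBag G F l :=
      (nbhd_comp_subset hl.isCompOf hN).imp_right And.right
    obtain ⟨h1, h2⟩ : τ <:+ l ∧ ∀ m, τ <:+ m → m <:+ l → v ∈ branchBag G F m := by
      by_cases hvp : v ∈ part F l
      · obtain rfl := hF.home_unique hτ hl.tail hvτ hvp
        refine ⟨List.suffix_rfl, fun m h1 h2 => ?_⟩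
        rwa [h2.eq_of_length_le h1.length_le]
      · exact ih hl.tail hb hvp (hb.resolve_right hvp)
    refine ⟨h1.trans (List.suffix_cons C l), fun m hm hml => ?_⟩
    rcases List.suffix_cons_iff.1 hml with rfl | h
    · exact hvl
    · exact h2 m hm h

theorem exists_bag_of_adj (hF : Exhausts G F) {x y : V} (h : G.Adj x y) :
    ∃ l, Branch G F l ∧ x ∈ branchBag G F l ∧ y ∈ branchBag G F l := by
  obtain ⟨l, hl, hxl⟩ := hF.exists_home x
  obtain ⟨m, hm, hym⟩ := hF.exists_home y
  by_cases hy : y ∈ top l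
  · refine ⟨m, hm, ?_, Or.inr hym⟩
    by_cases hx : x ∈ top m
    · have h1 := hF.suffix_home hl hm hxl hx
      have h2 := hF.suffix_home hm hl hym hy
      rw [h1.eq_of_length_le h2.length_le]
      exact Or.inr hxl
    · exact Or.inl ⟨hx, y, hF.part_subset hm hym, h.symm⟩
  · exact ⟨l, hl, Or.inr hxl, Or.inl ⟨hy, x, hF.part_subset hl hxl, h⟩⟩

theorem branchBag_inter (hF : Exhausts G F) {C : Set V} {l : List (Set V)}
    (h : Branch G F (C :: l)) : branchBag G F l ∩ branchBag G F (C :: l) = NbhdSet G C := by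
  ext v
  constructor
  · rintro ⟨hv, hvC | hvC⟩
    · exact hvC
    · have hvl := h.isCompOf.2.1 ((hF.isPart C h.piece).subset hvC)
      exact hv.elim (fun hv => absurd hvl.1 hv.1) fun hv => absurd hv hvl.2
  · exact fun hv => ⟨(nbhd_comp_subset h.isCompOf hv).imp_right And.right, Or.inl hv⟩

theorem iUnion_branchBag (hF : Exhausts G F) {l : List (Set V)} (hl : Branch G F l) :
    ⋃ m ∈ {m : {m // Branch G F m} | l <:+ m.1}, branchBag G F m.1 = top l ∪ NbhdSet G (top l) := by
  ext v
  simp only [Set.mem_iUnion, Set.mem_ofPred_eq, exists_prop]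
  constructor
  · rintro ⟨⟨m, hm⟩, hlm, hv⟩
    have hsub := hm.top_subset hlm
    by_cases hvl : v ∈ top l
    · exact Or.inl hvl
    · rcases hv with ⟨-, u, hu, huv⟩ | hv
      · exact Or.inr ⟨hvl, u, hsub hu, huv⟩
      · exact Or.inl (hsub (hF.part_subset hm hv))
  · rintro (hv | hv)
    · obtain ⟨m, hm, hvm⟩ := hF.exists_home v
      exact ⟨⟨m, hm⟩, hF.suffix_home hm hl hvm hv, Or.inr hvm⟩
    · exact ⟨⟨l, hl⟩, List.suffix_rfl, Or.inl hv⟩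

theorem finite_branchBag (hF : Exhausts G F) {l : List (Set V)} (h : Branch G F l) :
    (branchBag G F l).Finite := by
  cases l with
  | nil => simp [branchBag, top, part, NbhdSet]
  | cons C l =>
    exact (finite_nbhd_iff.1 (hF.ord_ne_top C h.piece)).union (hF.isPart C h.piece).finite

/-- The rooted tree-decomposition whose nodes are the branches. -/
def decomp (hF : Exhausts G F) : RootedTreeDecomp G (listTree (Branch G F)) where
  isTree := listTree_isTree Branch.nil fun _ _ h => h.tail
  bag l := branchBag G F l.1
  bag_cover v := by
    obtain ⟨l, hl, hv⟩ := hF.exists_home v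
    exact ⟨⟨l, hl⟩, Or.inr hv⟩
  bag_edge x y h := by
    obtain ⟨l, hl, hx, hy⟩ := hF.exists_bag_of_adj h
    exact ⟨⟨l, hl⟩, hx, hy⟩
  bag_conn v s t p hp hs ht x hx := by
    obtain ⟨τ, hτ, hvτ⟩ := hF.exists_home v
    have h1 := hF.mem_bag_between hτ hvτ s.2 hs
    have h2 := hF.mem_bag_between hτ hvτ t.2 ht
    obtain ⟨h3, h4 | h4⟩ := suffix_of_mem_path (m := ⟨τ, hτ⟩) Branch.nil (fun _ _ h => h.tail)
      h1.1 h2.1 hp hx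
    · exact h1.2 _ h3 h4
    · exact h2.2 _ h3 h4
  root := ⟨[], Branch.nil⟩

theorem decomp_le (hF : Exhausts G F) {s t : {l // Branch G F l}} :
    hF.decomp.le s t ↔ s.1 <:+ t.1 := by
  constructor
  · intro h
    have hp := (hF.decomp.isTree.existsUnique_path hF.decomp.root t).choose_spec.1
    obtain ⟨-, h1 | h1⟩ := suffix_of_mem_path (m := ⟨[], Branch.nil⟩) Branch.nil
      (fun _ _ h => h.tail) List.nil_suffix List.nil_suffix hp h
    · exact List.suffix_nil.1 h1 ▸ List.nil_suffix
    · exact h1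
  · exact fun h => mem_path_of_suffix (fun _ _ h => h.tail) _ List.nil_suffix h

theorem decomp_strictAbove (hF : Exhausts G F) {s t : {l // Branch G F l}} {C : Set V}
    (h : t.1 = C :: s.1) : hF.decomp.strictAbove s t = C := by
  obtain ⟨t, ht⟩ := t
  obtain rfl : t = C :: s.1 := h
  have h1 : hF.decomp.above ⟨C :: s.1, ht⟩ = C ∪ NbhdSet G C := by
    rw [RootedTreeDecomp.above]
    simp only [hF.decomp_le]
    exact hF.iUnion_branchBag ht
  rw [RootedTreeDecomp.strictAbove, h1]
  have h2 : hF.decomp.bag s ∩ hF.decomp.bag ⟨C :: s.1, ht⟩ = NbhdSet G C := hF.branchBag_inter ht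
  rw [h2, Set.union_sdiff_right]
  exact (Set.disjoint_left.2 fun v hv hvN => hvN.1 hv).sdiff_eq_left

theorem exists_eq_cons (hF : Exhausts G F) {s t : {l // Branch G F l}}
    (h : hF.decomp.IsOrientedEdge s t) : ∃ C, t.1 = C :: s.1 := by
  obtain ⟨⟨C, h⟩ | h, hle⟩ := h
  · have := (hF.decomp_le.1 hle).length_le
    rw [h] at this
    simp at this
  · exact h

theorem isCompOf_of_eq_cons {s t : {l // Branch G F l}} {C : Set V} (h : t.1 = C :: s.1) :
    IsCompOf G (top s.1 \ part F s.1) C :=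
  Branch.isCompOf (h ▸ t.2)

theorem decomp_componental (hF : Exhausts G F) : hF.decomp.Componental := by
  intro s t h
  obtain ⟨C, hC⟩ := hF.exists_eq_cons h
  rw [hF.decomp_strictAbove hC]
  exact (isCompOf_of_eq_cons hC).2.2.1

theorem decomp_tight (hF : Exhausts G F) : hF.decomp.Tight := by
  intro s t h
  obtain ⟨C, hC⟩ := hF.exists_eq_cons h
  rw [hF.decomp_strictAbove hC]
  refine ⟨C, isCompOf_self (isCompOf_of_eq_cons hC).2.2.1, ?_⟩
  have h2 := hF.branchBag_inter (hC ▸ t.2)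
  rw [← hC] at h2
  exact h2.symm

end Exhausts

/-- The neighbourhoods of the ends of a chain are joined by as many disjoint paths as the least
order along the chain permits. -/
theorem unseparated_of_chain {C F : ℕ → Set V} {n k : ℕ}
    (hcomp : ∀ i < n, IsCompOf G (C i \ F i) (C (i + 1)))
    (hpush : ∀ i < n, Pushes G (C i) (F i)) (hrob : ∀ i < n, Robust G (C i) (C (i + 1)))
    (hsub : C n ⊆ C 0) (hk : ∀ i ≤ n, (k : ℕ∞) ≤ ord G (C i)) :
    Unseparated G (NbhdSet G (C 0)) (NbhdSet G (C n)) k := by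
  intro S hS
  by_contra hcon
  have hjoin : ∀ a ∈ NbhdSet G (C 0), ∀ b ∈ NbhdSet G (C n), ¬ ConnAvoiding G (↑S : Set V) b a :=
    fun a ha b hb h => hcon ⟨a, ha, b, hb, by rw [compl_compl]; exact h.symm⟩
  set X : Set V := C n ∪ Reach G (↑S : Set V) (NbhdSet G (C n)) with hX
  have h0 : X ⊆ C 0 := by
    refine Set.union_subset hsub ?_
    rintro v ⟨b, hb, p, hp⟩
    have hb0 : b ∈ C 0 := by
      by_contra hb0
      have hbS := hp b p.start_mem_support
      obtain ⟨w, hw, hwb⟩ := hb.2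
      exact hjoin b ⟨hb0, w, hsub hw, hwb⟩ b hb (connAvoiding_refl hbS)
    by_contra hv
    obtain ⟨d, hd, hd1, hd2⟩ := p.exists_boundary_dart (C 0) hb0 hv
    classical
    have hmem := p.dart_snd_mem_support_of_mem_darts hd
    exact hjoin d.snd ⟨hd2, d.fst, hd1, d.adj⟩ b hb ⟨p.takeUntil d.snd hmem,
      fun x hx => hp x (p.support_takeUntil_subset_support hmem hx)⟩
  have hN : NbhdSet G X ⊆ ↑S := by
    rintro y ⟨hy, u, hu, huy⟩
    by_contra hyS
    refine hy ?_
    rcases hu with hu | hu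
    · by_cases hyC : y ∈ C n
      · exact Or.inl hyC
      · exact Or.inr ⟨y, ⟨hyC, u, hu, huy⟩, connAvoiding_refl hyS⟩
    · exact Or.inr (Reach.step hu huy hyS)
  obtain ⟨i, hi, hle⟩ := exists_ord_le_of_chain hcomp hpush hrob Set.subset_union_left h0
  have h1 : ord G X ≤ S.card := by
    rw [← Set.encard_coe_eq_coe_finsetCard]
    exact Set.encard_le_encard hN
  have h2 := ((hk i hi).trans hle).trans h1
  rw [Nat.cast_le] at h2
  omega

namespace Exhausts

theorem unseparated (hF : Exhausts G F) {s t : List (Set V)} {C : Set V} {k : ℕ}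
    (ht : Branch G F t) (hs : C :: s <:+ t)
    (hk : ∀ m, C :: s <:+ m → m <:+ t → (k : ℕ∞) ≤ ord G (top m)) :
    Unseparated G (NbhdSet G C) (NbhdSet G (top t)) k := by
  obtain ⟨q, hq⟩ := hs
  set n := q.length with hn
  have hlen : t.length = n + (s.length + 1) := by rw [← hq]; simp [hn]
  have h0 : t.drop n = C :: s := by rw [← hq, hn]; simp
  have hstep : ∀ i < n, ∃ D, t.drop (n - (i + 1)) = D :: t.drop (n - i) := by
    intro i hi
    refine ⟨t[n - (i + 1)], ?_⟩
    rw [List.drop_eq_getElem_cons (by omega : n - (i + 1) < t.length)]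
    congr 2
    omega
  have hsuf : ∀ i ≤ n, C :: s <:+ t.drop (n - i) := by
    intro i hi
    rw [← h0]
    have : t.drop n = (t.drop (n - i)).drop i := by rw [List.drop_drop]; congr 1; omega
    rw [this]
    exact List.drop_suffix _ _
  have hbr : ∀ i, Branch G F (t.drop (n - i)) := fun i => ht.of_suffix (List.drop_suffix _ _)
  have hpart : ∀ i ≤ n, IsPart G (top (t.drop (n - i))) (part F (t.drop (n - i))) := by
    intro i hi
    have h1 := hbr i
    have h2 := (hsuf i hi).length_le
    cases h : t.drop (n - i) with
    | nil => simp [h] at h2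
    | cons D l => exact hF.isPart D (h ▸ h1).piece
  have hcomp : ∀ i < n, IsCompOf G (top (t.drop (n - i)) \ part F (t.drop (n - i)))
      (top (t.drop (n - (i + 1)))) := by
    intro i hi
    obtain ⟨D, hD⟩ := hstep i hi
    have := hbr (i + 1)
    rw [hD] at this ⊢
    exact this.isCompOf
  have key := unseparated_of_chain (C := fun i => top (t.drop (n - i)))
    (F := fun i => part F (t.drop (n - i))) (n := n) (k := k) hcomp
    (fun i hi => (hpart i hi.le).pushes) (fun i hi => (hpart i hi.le).robust _ (hcomp i hi))
    (by simpa using ht.top_subset (List.drop_suffix n t))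
    (fun i hi => hk _ (hsuf i hi) (List.drop_suffix _ _))
  simpa [h0, top] using key

theorem decomp_adh (hF : Exhausts G F) {s t : {l // Branch G F l}} {C : Set V}
    (h : t.1 = C :: s.1) : hF.decomp.bag s ∩ hF.decomp.bag t = NbhdSet G (top t.1) := by
  have h2 := hF.branchBag_inter (h ▸ t.2)
  rw [← h] at h2
  rw [h]
  exact h2

theorem decomp_linked (hF : Exhausts G F) : hF.decomp.Linked := by
  intro s t hst hne
  rw [hF.decomp_le] at hst
  have hp := (hF.decomp.isTree.existsUnique_path s t).choose_spec.1
  obtain ⟨C, hC⟩ : ∃ C, C :: s.1 <:+ t.1 := by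
    obtain ⟨q, hq⟩ := hst
    rcases q.eq_nil_or_concat with rfl | ⟨q, D, rfl⟩
    · exact absurd (Subtype.ext hq) hne
    · exact ⟨D, q, by simpa using hq⟩
  have hbr : ∀ m, m <:+ t.1 → Branch G F m := fun m hm => t.2.of_suffix hm
  have hfin : ∀ m, C :: s.1 <:+ m → m <:+ t.1 → ord G (top m) ≠ ⊤ := by
    rintro (_ | ⟨D, m⟩) h1 h2
    · simp at h1
    · exact hF.ord_ne_top D (hbr _ h2).piece
  obtain ⟨m, ⟨hm1, hm2⟩, hmin⟩ := (InvImage.wf (fun m : List (Set V) => ord G (top m))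
    wellFounded_lt).has_min {m | C :: s.1 <:+ m ∧ m <:+ t.1} ⟨t.1, hC, List.suffix_rfl⟩
  have hmin' : ∀ m', C :: s.1 <:+ m' → m' <:+ t.1 → ord G (top m) ≤ ord G (top m') :=
    fun m' h1 h2 => not_lt.1 (hmin m' ⟨h1, h2⟩)
  have hNfin : ∀ m', C :: s.1 <:+ m' → m' <:+ t.1 → (NbhdSet G (top m')).Finite :=
    fun m' h1 h2 => finite_nbhd_iff.1 (hfin m' h1 h2)
  set k := (NbhdSet G (top m)).ncard with hk
  have hkord : (k : ℕ∞) = ord G (top m) := (hNfin m hm1 hm2).cast_ncard_eq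
  have hcard : ∀ a b : {l // Branch G F l}, a.1 ∈ {l | s.1 <:+ l} → b.1 <:+ t.1 →
      (∃ D, b.1 = D :: a.1) →
      (k : Cardinal.{u}) ≤ Cardinal.mk ↥(hF.decomp.bag a ∩ hF.decomp.bag b) := by
    rintro a b ha hb ⟨D, hD⟩
    have hb' : C :: s.1 <:+ b.1 := by
      refine List.suffix_of_suffix_length_le hC hb ?_
      have := List.IsSuffix.length_le ha
      rw [hD]
      simpa using this
    rw [hF.decomp_adh hD, ← Set.cast_ncard (hNfin _ hb' hb), Nat.cast_le]
    have := hmin' _ hb' hb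
    rw [← hkord, ord, ← (hNfin _ hb' hb).cast_ncard_eq, Nat.cast_le] at this
    exact this
  refine ⟨k, ?_, ?_, ULift (Fin k), by simp, ?_⟩
  · rintro a b ⟨hab, he⟩
    have ha := suffix_of_mem_path Branch.nil (fun _ _ h => h.tail) List.suffix_rfl hst hp
      (Walk.fst_mem_support_of_mem_edges _ he)
    have hb := suffix_of_mem_path Branch.nil (fun _ _ h => h.tail) List.suffix_rfl hst hp
      (Walk.snd_mem_support_of_mem_edges _ he)
    rcases hab with hab | hab
    · rw [Set.inter_comm]
      exact hcard b a hb.1 (ha.2.elim (fun h => h.trans hst) id) hab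
    · exact hcard a b ha.1 (hb.2.elim (fun h => h.trans hst) id) hab
  · rcases m with _ | ⟨D, l⟩
    · simp at hm1
    · refine ⟨⟨l, (hbr _ hm2).tail⟩, ⟨D :: l, hbr _ hm2⟩, ⟨Or.inr ⟨D, rfl⟩,
        mem_edges_of_suffix (m := ⟨D :: l, hbr _ hm2⟩) rfl _ (fun h => ?_) hm2⟩, ?_⟩
      · have := (hm1.trans h).length_le
        simp at this
      · rw [hF.decomp_adh (C := D) rfl, ← Set.cast_ncard (hNfin _ hm1 hm2)]
  · have hU := hF.unseparated (k := k) t.2 hC fun m' h1 h2 => hkord.trans_le (hmin' m' h1 h2)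
    obtain ⟨a, b, p, hp, ha, hb, hd⟩ := (hU.linkage.reindex Equiv.ulift).disjointPathsFam
    refine ⟨a, b, p, hp, fun i => ?_, fun i => Or.inl (hb i), hd⟩
    have hcomp := (hbr _ hC).isCompOf
    exact (nbhd_comp_subset hcomp (ha i)).imp_right And.right

end Exhausts

end LinkedDecomp

/-- Every graph that admits a tree-decomposition into finite parts admits a
rooted tree-decomposition into finite parts that is simultaneously linked, tight and
componental. -/
theorem statement_2 {V : Type u} {M : Type v} (G : SimpleGraph V)
    (T : SimpleGraph M) (D : TreeDecomp G T) (hD : D.FiniteParts) :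
    ∃ (M' : Type u) (T' : SimpleGraph M') (D' : RootedTreeDecomp G T'),
      D'.toTreeDecomp.FiniteParts ∧ D'.Linked ∧ D'.Tight ∧ D'.Componental := by
  obtain ⟨h, hh⟩ := LinkedDecomp.exists_height D hD
  obtain ⟨F, hF, hFe⟩ := LinkedDecomp.exists_partition_function hh
  have hE : LinkedDecomp.Exhausts G F := ⟨fun C hC => (hF C hC).1, fun C hC => (hF C hC).2, hFe⟩
  exact ⟨_, _, hE.decomp, fun t => hE.finite_branchBag t.2, hE.decomp_linked, hE.decomp_tight,
    hE.decomp_componental⟩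
end

section
/- There exists a countable connected graph G such that for every tree-decomposition (T, (V_t)) of G into finite parts there are a node t of T, a natural number ℓ, and sets Z_1, Z_2 ⊆ V_t with |Z_1| = |Z_2| = ℓ such that G contains no ℓ pairwise disjoint Z_1–Z_2 paths; in particular, every tree-decomposition of G into finite parts has a bag that violates the leanness condition for s = t. -/
open SimpleGraph

universe u v

section WalkConnected

variable {N : Type v} {T : SimpleGraph N}

/-- Any two vertices of `S` are joined by a walk of `T` inside `S`. -/
def WalkConnected (T : SimpleGraph N) (S : Set N) : Prop :=
  ∀ a ∈ S, ∀ b ∈ S, ∃ p : T.Walk a b, ∀ x ∈ p.support, x ∈ S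

theorem WalkConnected.of_hub {S : Set N} {c : N}
    (h : ∀ a ∈ S, ∃ p : T.Walk a c, ∀ x ∈ p.support, x ∈ S) : WalkConnected T S := by
  intro a ha b hb
  obtain ⟨p, hp⟩ := h a ha
  obtain ⟨q, hq⟩ := h b hb
  refine ⟨p.append q.reverse, fun x hx => ?_⟩
  rw [Walk.mem_support_append_iff, Walk.support_reverse, List.mem_reverse] at hx
  exact hx.elim (hp x) (hq x)

theorem WalkConnected.union {A B : Set N} (hA : WalkConnected T A) (hB : WalkConnected T B)
    (hAB : (A ∩ B).Nonempty) : WalkConnected T (A ∪ B) := by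
  obtain ⟨c, hcA, hcB⟩ := hAB
  refine WalkConnected.of_hub (c := c) ?_
  rintro a (ha | ha)
  · obtain ⟨p, hp⟩ := hA a ha c hcA
    exact ⟨p, fun x hx => Or.inl (hp x hx)⟩
  · obtain ⟨p, hp⟩ := hB a ha c hcB
    exact ⟨p, fun x hx => Or.inr (hp x hx)⟩

/-- In an acyclic graph a path only uses edges of any other walk with the same ends. -/
theorem SimpleGraph.IsAcyclic.edges_subset_of_isPath (hT : T.IsAcyclic) {a b : N}
    {p : T.Walk a b} (hp : p.IsPath) (q : T.Walk a b) : p.edges ⊆ q.edges := by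
  classical
  have h : p = q.bypass :=
    congrArg Subtype.val ((hT.subsingleton_path a b).elim ⟨p, hp⟩ ⟨q.bypass, q.bypass_isPath⟩)
  rw [h]
  exact q.edges_bypass_subset_edges

/-- In an acyclic graph a path only uses vertices of any other walk with the same ends. -/
theorem SimpleGraph.IsAcyclic.support_subset_of_isPath (hT : T.IsAcyclic) {a b : N}
    {p : T.Walk a b} (hp : p.IsPath) (q : T.Walk a b) : p.support ⊆ q.support := by
  classical
  have h : p = q.bypass :=
    congrArg Subtype.val ((hT.subsingleton_path a b).elim ⟨p, hp⟩ ⟨q.bypass, q.bypass_isPath⟩)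
  rw [h]
  exact q.support_bypass_subset_support

theorem WalkConnected.inter (hT : T.IsAcyclic) {A B : Set N} (hA : WalkConnected T A)
    (hB : WalkConnected T B) : WalkConnected T (A ∩ B) := by
  classical
  intro a ha b hb
  obtain ⟨p, hp⟩ := hA a ha.1 b hb.1
  obtain ⟨q, hq⟩ := hB a ha.2 b hb.2
  refine ⟨p.bypass, fun x hx => ⟨hp x (p.support_bypass_subset_support hx), hq x ?_⟩⟩
  exact hT.support_subset_of_isPath p.bypass_isPath q hx

theorem WalkConnected.support {a b : N} (p : T.Walk a b) :
    WalkConnected T {x | x ∈ p.support} := by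
  classical
  refine WalkConnected.of_hub (c := a) fun x hx => ⟨(p.takeUntil x hx).reverse, fun y hy => ?_⟩
  rw [Walk.support_reverse, List.mem_reverse] at hy
  exact p.support_takeUntil_subset_support hx hy

theorem SimpleGraph.Walk.exists_mem_inter_of_edges {B C : Set N} {b c : N} (p : T.Walk b c)
    (hb : b ∈ C) (hc : c ∈ B)
    (h : ∀ x y, s(x, y) ∈ p.edges → (x ∈ C ∧ y ∈ C) ∨ (x ∈ B ∧ y ∈ B)) :
    ∃ x ∈ p.support, x ∈ B ∧ x ∈ C := by
  induction p with
  | nil => exact ⟨_, by simp, hc, hb⟩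
  | cons hadj p ih =>
    rcases h _ _ (List.mem_cons_self ..) with hend | hend
    · obtain ⟨x, hx, hx'⟩ := ih hend.2 hc fun x y hxy => h x y (List.mem_cons_of_mem _ hxy)
      exact ⟨x, by simp [hx], hx'⟩
    · exact ⟨_, by simp, hend.1, hb⟩

/-- The Helly property for three subtrees. -/
theorem WalkConnected.helly_three (hT : T.IsAcyclic) {A B C : Set N} (hA : WalkConnected T A)
    (hB : WalkConnected T B) (hC : WalkConnected T C) (hAB : (A ∩ B).Nonempty)
    (hAC : (A ∩ C).Nonempty) (hBC : (B ∩ C).Nonempty) : (A ∩ B ∩ C).Nonempty := by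
  classical
  obtain ⟨a, haB, haC⟩ := hBC
  obtain ⟨b, hbA, hbC⟩ := hAC
  obtain ⟨c, hcA, hcB⟩ := hAB
  obtain ⟨p, hp⟩ := hA b hbA c hcA
  obtain ⟨q, hq⟩ := hC b hbC a haC
  obtain ⟨r, hr⟩ := hB a haB c hcB
  obtain ⟨x, hx, hxB, hxC⟩ := p.bypass.exists_mem_inter_of_edges hbC hcB (by
    intro x y hxy
    have h := hT.edges_subset_of_isPath p.bypass_isPath (q.append r) hxy
    rw [Walk.edges_append, List.mem_append] at h
    rcases h with h | h
    · exact Or.inl ⟨hq _ (q.fst_mem_support_of_mem_edges h),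
        hq _ (q.snd_mem_support_of_mem_edges h)⟩
    · exact Or.inr ⟨hr _ (r.fst_mem_support_of_mem_edges h),
        hr _ (r.snd_mem_support_of_mem_edges h)⟩)
  exact ⟨x, ⟨hp x (p.support_bypass_subset_support hx), hxB⟩, hxC⟩

/-- The Helly property for finitely many subtrees. -/
theorem WalkConnected.helly (hT : T.IsAcyclic) {ι : Type*} (s : Finset ι) (f : ι → Set N)
    (hf : ∀ i ∈ s, WalkConnected T (f i)) (hff : ∀ i ∈ s, ∀ j ∈ s, (f i ∩ f j).Nonempty)
    (A : Set N) (hA : WalkConnected T A) (hA' : A.Nonempty)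
    (hAf : ∀ i ∈ s, (A ∩ f i).Nonempty) : ∃ t ∈ A, ∀ i ∈ s, t ∈ f i := by
  classical
  induction s using Finset.induction_on generalizing A with
  | empty => obtain ⟨t, ht⟩ := hA'; exact ⟨t, ht, by simp⟩
  | insert i s _ ih =>
    have hi := Finset.mem_insert_self i s
    have hs : ∀ j ∈ s, j ∈ insert i s := fun j hj => Finset.mem_insert_of_mem hj
    obtain ⟨t, ht, hts⟩ := ih (fun j hj => hf j (hs j hj))
      (fun j hj k hk => hff j (hs j hj) k (hs k hk)) (A ∩ f i) (hA.inter hT (hf i hi))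
      (hAf i hi) (fun j hj => hA.helly_three hT (hf i hi) (hf j (hs j hj)) (hAf i hi)
        (hAf j (hs j hj)) (hff i hi j (hs j hj)))
    refine ⟨t, ht.1, fun j hj => ?_⟩
    rcases Finset.mem_insert.1 hj with rfl | hj
    · exact ht.2
    · exact hts j hj

end WalkConnected

namespace TreeDecomp

variable {V : Type u} {N : Type v} {G : SimpleGraph V} {T : SimpleGraph N}

/-- The nodes whose bags meet `X`. -/
def nodesMeeting (D : TreeDecomp G T) (X : Set V) : Set N := {t | ∃ x ∈ X, x ∈ D.bag t}

theorem exists_walk_of_walk (D : TreeDecomp G T) {X : Set V} {x y : V} (p : G.Walk x y)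
    (hp : ∀ z ∈ p.support, z ∈ X) {s t : N} (hs : x ∈ D.bag s) (ht : y ∈ D.bag t) :
    ∃ q : T.Walk s t, ∀ r ∈ q.support, r ∈ D.nodesMeeting X := by
  induction p generalizing s with
  | nil =>
    obtain ⟨q, hq, -⟩ := D.isTree.existsUnique_path s t
    exact ⟨q, fun r hr => ⟨_, hp _ (by simp), D.bag_conn _ q hq hs ht r hr⟩⟩
  | cons h p ih =>
    obtain ⟨s', hs', hs''⟩ := D.bag_edge h
    obtain ⟨q, hq, -⟩ := D.isTree.existsUnique_path s s'
    obtain ⟨q', hq'⟩ := ih (fun z hz => hp z (by simp [hz])) hs'' ht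
    refine ⟨q.append q', fun r hr => ?_⟩
    rw [Walk.mem_support_append_iff] at hr
    rcases hr with hr | hr
    · exact ⟨_, hp _ (by simp), D.bag_conn _ q hq hs hs' r hr⟩
    · exact hq' r hr

theorem walkConnected_nodesMeeting (D : TreeDecomp G T) {X : Set V} (hX : WalkConnected G X) :
    WalkConnected T (D.nodesMeeting X) := by
  rintro s ⟨x, hx, hs⟩ t ⟨y, hy, ht⟩
  obtain ⟨p, hp⟩ := hX x hx y hy
  exact D.exists_walk_of_walk p hp hs ht

theorem walkConnected_nodes (D : TreeDecomp G T) (v : V) :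
    WalkConnected T {t | v ∈ D.bag t} := by
  intro s hs t ht
  obtain ⟨q, hq, -⟩ := D.isTree.existsUnique_path s t
  exact ⟨q, fun r hr => D.bag_conn v q hq hs ht r hr⟩

end TreeDecomp

/-- Disjoint `A`–`B` paths all meeting a finite set `S` number at most `|S|`. -/
theorem DisjointPaths.le_card {V : Type u} {G : SimpleGraph V} {A B : Set V} {n : ℕ}
    (h : DisjointPaths G A B n) (S : Finset V)
    (hS : ∀ a ∈ A, ∀ b ∈ B, ∀ p : G.Walk a b, ∃ x ∈ p.support, x ∈ S) : n ≤ S.card := by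
  obtain ⟨a, b, p, -, ha, hb, hdis⟩ := h
  choose f hf hfS using fun i => hS (a i) (ha i) (b i) (hb i) (p i)
  have hinj : Function.Injective f := by
    intro i j hij
    by_contra hne
    exact hdis hne (f i) (hf i) (hij ▸ hf j)
  simpa using Finset.card_le_card_of_injOn (s := Finset.univ) f (fun i _ => hfS i) hinj.injOn

namespace CliqueRayGraph

/-- The oriented edges of the graph with hub `0`, an infinite clique formed by the odd
numbers, and a ray formed by the positive even numbers: the hub is joined to the whole clique,
and the `l`-th clique vertex is joined to the `n`-th ray vertex iff `l ≤ n`. -/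
inductive Rel : ℕ → ℕ → Prop
  | hub (l : ℕ) : Rel 0 (2 * l + 1)
  | clique (k l : ℕ) (h : k < l) : Rel (2 * k + 1) (2 * l + 1)
  | rung (l n : ℕ) (h : l ≤ n) : Rel (2 * l + 1) (2 * n + 2)
  | ray (n : ℕ) : Rel (2 * n + 2) (2 * (n + 1) + 2)

/-- The graph with edges `Rel`. -/
def graph : SimpleGraph ℕ := SimpleGraph.fromRel Rel

theorem Rel.ne {x y : ℕ} (h : Rel x y) : x ≠ y := by
  cases h <;> omega

theorem Rel.adj {x y : ℕ} (h : Rel x y) : graph.Adj x y :=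
  (SimpleGraph.fromRel_adj _ _ _).2 ⟨h.ne, Or.inl h⟩

theorem connected : graph.Connected := by
  have hw : ∀ l, graph.Reachable (2 * l + 1) 0 := fun l => (Rel.hub l).adj.symm.reachable
  have h : ∀ x, graph.Reachable x 0 := by
    intro x
    obtain ⟨k, rfl | rfl⟩ := x.even_or_odd'
    · rcases k with _ | n
      · exact Reachable.refl _
      · exact (Rel.rung 0 n (Nat.zero_le n)).adj.symm.reachable.trans (hw 0)
    · exact hw k
  exact { preconnected := fun x y => (h x).trans (h y).symm, nonempty := ⟨0⟩ }

/-- The clique consisting of the first `m + 1` clique vertices and the ray vertex `m + 1`. -/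
def sep (m : ℕ) : Finset ℕ :=
  insert (2 * (m + 1) + 2) ((Finset.range (m + 1)).image fun l => 2 * l + 1)

theorem mem_sep {m x : ℕ} : x ∈ sep m ↔ x = 2 * (m + 1) + 2 ∨ ∃ l ≤ m, x = 2 * l + 1 := by
  simp only [sep, Finset.mem_insert, Finset.mem_image, Finset.mem_range, Nat.lt_succ_iff]
  simp only [eq_comm]

/-- The ray vertices separated from the hub by `sep m`. -/
def near (m : ℕ) : Set ℕ := {x | ∃ n ≤ m, x = 2 * n + 2}

/-- The vertices on the hub's side of `sep m`. -/
def far (m : ℕ) : Set ℕ := {x | x ∉ near m ∧ x ∉ sep m}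

theorem mem_sep_of_adj_near {m x y : ℕ} (hx : x ∈ near m) (h : graph.Adj x y)
    (hy : y ∉ near m) : y ∈ sep m := by
  obtain ⟨n, hn, rfl⟩ := hx
  rw [mem_sep]
  simp only [near, Set.mem_ofPred_eq, not_exists, not_and] at hy
  rcases (SimpleGraph.fromRel_adj _ _ _).1 h with ⟨-, h | h⟩
  · generalize hz : 2 * n + 2 = z at h
    cases h with
    | hub l => omega
    | clique k l h => omega
    | rung l k h => omega
    | ray k => left; have := hy (k + 1); omega
  · generalize hz : 2 * n + 2 = z at h
    cases h with
    | hub l => omega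
    | clique k l h => omega
    | rung l k h => exact Or.inr ⟨l, by omega, rfl⟩
    | ray k => exact absurd rfl (hy k (by omega))

theorem exists_mem_sep {m x y : ℕ} (hx : x ∈ near m) (hy : y ∉ near m) (p : graph.Walk x y) :
    ∃ z ∈ p.support, z ∈ sep m := by
  induction p with
  | nil => exact absurd hx hy
  | @cons x x' y h p ih =>
    by_cases hx' : x' ∈ near m
    · obtain ⟨z, hz, hz'⟩ := ih hx' hy
      exact ⟨z, by simp [hz], hz'⟩
    · exact ⟨x', by simp, mem_sep_of_adj_near hx h hx'⟩

theorem zero_mem_far (m : ℕ) : 0 ∈ far m := by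
  refine ⟨?_, ?_⟩
  · rintro ⟨n, -, h⟩; omega
  · rw [mem_sep]; rintro (h | ⟨l, -, h⟩) <;> omega

theorem ray_mem_far (m : ℕ) : 2 * (m + 2) + 2 ∈ far m := by
  refine ⟨?_, ?_⟩
  · rintro ⟨n, hn, h⟩; omega
  · rw [mem_sep]; rintro (h | ⟨l, -, h⟩) <;> omega

theorem walkConnected_far (m : ℕ) : WalkConnected graph (far m) := by
  have hw : ∀ l, 2 * l + 1 ∈ far m →
      ∃ p : graph.Walk (2 * l + 1) 0, ∀ z ∈ p.support, z ∈ far m := fun l hl =>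
    ⟨(Rel.hub l).adj.symm.toWalk, by simp [hl, zero_mem_far]⟩
  have key : ∀ x ∈ far m, ∃ p : graph.Walk x 0, ∀ z ∈ p.support, z ∈ far m := by
    intro x hx
    obtain ⟨k, rfl | rfl⟩ := x.even_or_odd'
    · rcases k with _ | n
      · exact ⟨Walk.nil, by simpa using hx⟩
      · have hn : m + 1 ≤ n := by
          by_contra hlt
          exact hx.1 ⟨n, by omega, by ring⟩
        have hm : 2 * (m + 1) + 1 ∈ far m := by
          refine ⟨?_, ?_⟩
          · rintro ⟨k, -, h⟩; omega
          · rw [mem_sep]; rintro (h | ⟨l, hl, h⟩) <;> omega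
        obtain ⟨p, hp⟩ := hw (m + 1) hm
        refine ⟨Walk.cons (Rel.rung (m + 1) n hn).adj.symm p, fun z hz => ?_⟩
        rw [Walk.support_cons, List.mem_cons] at hz
        rcases hz with rfl | hz
        · exact hx
        · exact hp z hz
    · exact hw k hx
  exact WalkConnected.of_hub key

theorem walkConnected_ray : WalkConnected graph {x | ∃ n, x = 2 * n + 2} := by
  have key : ∀ n, ∃ p : graph.Walk (2 * n + 2) (2 * 0 + 2),
      ∀ z ∈ p.support, ∃ n, z = 2 * n + 2 := by
    intro n
    induction n with
    | zero => exact ⟨Walk.nil, fun z hz => ⟨0, by simpa using hz⟩⟩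
    | succ n ih =>
      obtain ⟨p, hp⟩ := ih
      refine ⟨Walk.cons (Rel.ray n).adj.symm p, fun z hz => ?_⟩
      rw [Walk.support_cons, List.mem_cons] at hz
      rcases hz with rfl | hz
      · exact ⟨n + 1, rfl⟩
      · exact hp z hz
  refine WalkConnected.of_hub (c := 2 * 0 + 2) ?_
  rintro _ ⟨n, rfl⟩
  exact key n

theorem adj_of_mem_insert_sep {m x y : ℕ} (hx : x ∈ insert (2 * m + 2) (sep m))
    (hy : y ∈ insert (2 * m + 2) (sep m)) (hxy : x < y) : graph.Adj x y := by
  rw [Finset.mem_insert, mem_sep] at hx hy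
  rcases hx with rfl | rfl | ⟨k, hk, rfl⟩ <;> rcases hy with rfl | rfl | ⟨l, hl, rfl⟩
  · omega
  · exact (Rel.ray m).adj
  · exact (Rel.rung l m hl).adj.symm
  · omega
  · omega
  · exact (Rel.rung l (m + 1) (by omega)).adj.symm
  · exact (Rel.rung k m hk).adj
  · exact (Rel.rung k (m + 1) (by omega)).adj
  · exact (Rel.clique k l (by omega)).adj

variable {N : Type v} {T : SimpleGraph N}

/-- If all parts are finite, then the hub shares a bag with a ray vertex. -/
theorem exists_bag_zero_ray (D : TreeDecomp graph T) (hD : D.FiniteParts) :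
    ∃ (m : ℕ) (t : N), 0 ∈ D.bag t ∧ 2 * m + 2 ∈ D.bag t := by
  obtain ⟨v, hv⟩ := D.bag_cover 0
  obtain ⟨u, hu⟩ := D.bag_cover (2 * 0 + 2)
  obtain ⟨P, -, -⟩ := D.isTree.existsUnique_path u v
  have hF : (⋃ x ∈ {x | x ∈ P.support}, D.bag x).Finite :=
    (List.finite_toSet P.support).biUnion fun x _ => hD x
  obtain ⟨l, hl⟩ : ∃ l, 2 * l + 1 ∉ ⋃ x ∈ {x | x ∈ P.support}, D.bag x := by
    by_contra! h
    refine Set.infinite_range_of_injective (f := fun l : ℕ => 2 * l + 1) ?_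
      (hF.subset (Set.range_subset_iff.2 h))
    intro i j hij
    simpa using hij
  obtain ⟨r, hr, hr'⟩ := D.bag_edge (Rel.hub l).adj
  obtain ⟨s, hs, hs'⟩ := D.bag_edge (Rel.rung l l le_rfl).adj
  have hU := (D.walkConnected_nodesMeeting walkConnected_ray).union (WalkConnected.support P)
    ⟨u, ⟨_, ⟨0, rfl⟩, hu⟩, P.start_mem_support⟩
  obtain ⟨t, ⟨ht, ht0⟩, htl⟩ := hU.helly_three D.isTree.isAcyclic (D.walkConnected_nodes 0)
    (D.walkConnected_nodes (2 * l + 1)) ⟨v, Or.inr P.end_mem_support, hv⟩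
    ⟨s, Or.inl ⟨_, ⟨l, rfl⟩, hs'⟩, hs⟩ ⟨r, hr, hr'⟩
  rcases ht with ⟨_, ⟨m, rfl⟩, hm⟩ | ht
  · exact ⟨m, t, ht0, hm⟩
  · exact absurd (Set.mem_biUnion ht htl) hl

/-- If all parts are finite, then some bag contains `sep m` and vertices on both sides. -/
theorem exists_bag_sep (D : TreeDecomp graph T) (hD : D.FiniteParts) :
    ∃ (m : ℕ) (t : N), (∀ x ∈ insert (2 * m + 2) (sep m), x ∈ D.bag t) ∧
      ∃ y ∈ far m, y ∈ D.bag t := by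
  obtain ⟨m, r, hr0, hrm⟩ := exists_bag_zero_ray D hD
  obtain ⟨t, ⟨y, hy, hyt⟩, ht⟩ := WalkConnected.helly D.isTree.isAcyclic
    (insert (2 * m + 2) (sep m)) (fun x => {t | x ∈ D.bag t})
    (fun x _ => D.walkConnected_nodes x)
    (by
      intro x hx y hy
      rcases lt_trichotomy x y with h | rfl | h
      · exact D.bag_edge (adj_of_mem_insert_sep hx hy h)
      · obtain ⟨t, ht⟩ := D.bag_cover x
        exact ⟨t, ht, ht⟩
      · exact D.bag_edge (adj_of_mem_insert_sep hy hx h).symm)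
    (D.nodesMeeting (far m)) (D.walkConnected_nodesMeeting (walkConnected_far m))
    ⟨r, 0, zero_mem_far m, hr0⟩
    (by
      intro x hx
      rw [Finset.mem_insert, mem_sep] at hx
      rcases hx with rfl | rfl | ⟨l, -, rfl⟩
      · exact ⟨r, ⟨0, zero_mem_far m, hr0⟩, hrm⟩
      · obtain ⟨s, hs, hs'⟩ := D.bag_edge (Rel.ray (m + 1)).adj
        exact ⟨s, ⟨_, ray_mem_far m, hs'⟩, hs⟩
      · obtain ⟨s, hs, hs'⟩ := D.bag_edge (Rel.hub l).adj
        exact ⟨s, ⟨0, zero_mem_far m, hs⟩, hs'⟩)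
  exact ⟨m, t, ht, y, hy, hyt⟩

theorem disjoint_near_sep {m x : ℕ} (hx : x ∈ near m) : x ∉ sep m := by
  obtain ⟨n, hn, rfl⟩ := hx
  rw [mem_sep]
  rintro (h | ⟨l, -, h⟩) <;> omega

theorem not_disjointPaths {m y : ℕ} (hy : y ∈ far m) :
    ¬ DisjointPaths graph ↑(insert (2 * m + 2) (sep m)) ↑(insert y (sep m))
      ((sep m).card + 1) := by
  intro h
  refine absurd (h.le_card (sep m) fun a ha b hb p => ?_) (by omega)
  rw [Finset.mem_coe, Finset.mem_insert] at ha hb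
  rcases ha with rfl | ha
  · refine exists_mem_sep ⟨m, le_rfl, rfl⟩ ?_ p
    rcases hb with rfl | hb
    · exact hy.1
    · exact fun hb' => disjoint_near_sep hb' hb
  · exact ⟨a, p.start_mem_support, ha⟩

end CliqueRayGraph

/-- There exists a countable connected graph `G` such that for every
tree-decomposition of `G` into finite parts there are a node `t`, a natural number `ℓ`,
and sets `Z₁, Z₂ ⊆ V_t` with `|Z₁| = |Z₂| = ℓ` such that `G` contains no `ℓ` pairwise
disjoint `Z₁`–`Z₂` paths. -/
theorem statement_5 :
    ∃ G : SimpleGraph ℕ, G.Connected ∧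
      ∀ (M : Type v) (T : SimpleGraph M) (D : TreeDecomp G T), D.FiniteParts →
        ∃ (t : M) (ℓ : ℕ) (Z1 Z2 : Finset ℕ),
          ↑Z1 ⊆ D.bag t ∧ ↑Z2 ⊆ D.bag t ∧ Z1.card = ℓ ∧ Z2.card = ℓ ∧
            ¬ DisjointPaths G ↑Z1 ↑Z2 ℓ := by
  refine ⟨CliqueRayGraph.graph, CliqueRayGraph.connected, fun M T D hD => ?_⟩
  obtain ⟨m, t, ht, y, hy, hyt⟩ := CliqueRayGraph.exists_bag_sep D hD
  refine ⟨t, (CliqueRayGraph.sep m).card + 1, insert (2 * m + 2) (CliqueRayGraph.sep m),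
    insert y (CliqueRayGraph.sep m), ht, fun x hx => ?_,
    Finset.card_insert_of_notMem (CliqueRayGraph.disjoint_near_sep ⟨m, le_rfl, rfl⟩),
    Finset.card_insert_of_notMem hy.2, CliqueRayGraph.not_disjointPaths hy⟩
  rcases Finset.mem_insert.1 hx with rfl | hx
  · exact hyt
  · exact ht x (Finset.mem_insert_of_mem hx)
end
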